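/- arXiv:1108.3398 — 6 statements merged into one kernel-verified Lean document; each statement's English description precedes it below -/
import Mathlib

section
/- Let X be a complex Banach space, A : D(A) → X a densely defined closed linear operator, a > 0, and K a compact subset of (−a, a) such that for every t ∈ ℝ \ K the operator it·I − A : D(A) → X is bijective with bounded inverse R(t) := (it − A)^{−1} ∈ L(X). Let F ⊆ ℝ be a closed set with F ∩ K = ∅. Then there exist H ∈ C^∞(ℝ, L(X)) and a compact set M with K ⊆ M ⊆ ℝ \ F such that H(t) = R(t) for all t ∈ ℝ \ M and H(s)x ∈ D(A) for all s ∈ ℝ and x ∈ X. -/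
open MeasureTheory Filter Complex

/-- If `T * (1 + c(t) S)` is constantly `S` near `s`, with `c` smooth and `c s = 0`, then `T` is
smooth at `s`. -/
theorem contDiffAt_of_mul_one_add_smul_eq {𝔸 : Type*} [NormedRing 𝔸] [NormedAlgebra ℂ 𝔸]
    [HasSummableGeomSeries 𝔸] {T : ℝ → 𝔸} {S : 𝔸} {c : ℝ → ℂ} {s : ℝ} {n : WithTop ℕ∞}
    (hc : ContDiff ℝ n c) (hcs : c s = 0)
    (h : ∀ᶠ t in nhds s, T t * (1 + c t • S) = S) : ContDiffAt ℝ n T s := by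
  let U : ℝ → 𝔸 := fun t => 1 + c t • S
  have hU : ContDiff ℝ n U := contDiff_const.add (hc.smul contDiff_const)
  have hUs : U s = ((1 : 𝔸ˣ) : 𝔸) := by simp [U, hcs]
  have hcont : ContinuousAt U s := hU.continuous.continuousAt
  have hunit : ∀ᶠ t in nhds s, IsUnit (U t) :=
    hcont.eventually (Units.isOpen.mem_nhds (by rw [hUs]; exact (1 : 𝔸ˣ).isUnit))
  have hinv : ContDiffAt ℝ n (fun t => Ring.inverse (U t)) s := by
    have := contDiffAt_ringInverse ℝ (n := n) (1 : 𝔸ˣ)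
    rw [← hUs] at this
    exact this.comp s hU.contDiffAt
  refine (contDiffAt_const (c := S) |>.mul hinv).congr_of_eventuallyEq ?_
  filter_upwards [h, hunit] with t ht hu
  calc T t = T t * U t * Ring.inverse (U t) := (Ring.mul_inverse_cancel_right _ _ hu).symm
    _ = S * Ring.inverse (U t) := by rw [ht]

/-- Let `A : D(A) → X` be a densely defined closed linear
operator, `a > 0`, `K` compact `⊆ (-a, a)` such that for every `t ∈ ℝ \ K` the
operator `it·I - A` is bijective with bounded inverse `R(t) ∈ L(X)`.  Let
`F ⊆ ℝ` be closed with `F ∩ K = ∅`.  Then there exist `H ∈ C^∞(ℝ, L(X))` and a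
compact `M` with `K ⊆ M ⊆ ℝ \ F`, `H = R` on `ℝ \ M` and `H(s)x ∈ D(A)` for all
`s ∈ ℝ`, `x ∈ X`. -/
theorem stmt7 {X : Type*} [NormedAddCommGroup X] [NormedSpace ℂ X] [CompleteSpace X]
    (D : Submodule ℂ X) (A : D →ₗ[ℂ] X)
    (hdense : Dense (D : Set X))
    (hclosed : IsClosed {p : X × X | ∃ h : p.1 ∈ D, A ⟨p.1, h⟩ = p.2})
    (a : ℝ) (ha : 0 < a) (K : Set ℝ) (hK : IsCompact K)
    (hKa : K ⊆ Set.Ioo (-a) a)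
    (R : ℝ → X →L[ℂ] X)
    (hR_mem : ∀ t : ℝ, t ∉ K → ∀ x : X, R t x ∈ D)
    (hR_right : ∀ (t : ℝ) (ht : t ∉ K) (x : X),
      (Complex.I * t) • (R t x) - A ⟨R t x, hR_mem t ht x⟩ = x)
    (hR_left : ∀ (t : ℝ), t ∉ K → ∀ y : D,
      R t ((Complex.I * t) • (y : X) - A y) = (y : X))
    (F : Set ℝ) (hF : IsClosed F) (hFK : F ∩ K = ∅) :
    ∃ (H : ℝ → X →L[ℂ] X) (M : Set ℝ),
      ContDiff ℝ (⊤ : ℕ∞) H ∧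
      IsCompact M ∧ K ⊆ M ∧ M ⊆ Fᶜ ∧
      (∀ t : ℝ, t ∉ M → H t = R t) ∧
      (∀ (s : ℝ) (x : X), H s x ∈ D) := by
  have hR_smooth : ∀ s : ℝ, s ∉ K → ContDiffAt ℝ (⊤ : ℕ∞) R s := by
    intro s hs
    refine contDiffAt_of_mul_one_add_smul_eq (S := R s)
      (c := fun t : ℝ => Complex.I * ((t : ℂ) - (s : ℂ))) ?_ (by simp) ?_
    · exact contDiff_const.mul (Complex.ofRealCLM.contDiff.sub contDiff_const)
    · filter_upwards [hK.isClosed.isOpen_compl.mem_nhds hs] with t ht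
      ext x
      have hr := hR_right s hs x
      have hl := hR_left t ht ⟨R s x, hR_mem s hs x⟩
      have key : x + (Complex.I * ((t : ℂ) - (s : ℂ))) • R s x
          = (Complex.I * t) • R s x - A ⟨R s x, hR_mem s hs x⟩ := by
        nth_rewrite 1 [← hr]
        module
      change R t (x + (Complex.I * ((t : ℂ) - (s : ℂ))) • R s x) = R s x
      rw [key]
      exact hl
  have hKF : K ⊆ Fᶜ := fun x hx hxF => (hFK.subset ⟨hxF, hx⟩ : x ∈ (∅ : Set ℝ))
  obtain ⟨M, hM, hKM, hMF⟩ := exists_compact_between hK hF.isOpen_compl hKF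
  obtain ⟨N, hN, hKN, hNM⟩ := exists_compact_between hK isOpen_interior hKM
  obtain ⟨φ, hφ0, hφ1, -⟩ := exists_contMDiffMap_zero_one_of_isClosed
    (modelWithCornersSelf ℝ ℝ) (n := (⊤ : ℕ∞)) hN.isClosed
    (isOpen_interior (s := M)).isClosed_compl
    (Set.disjoint_compl_right_iff_subset.mpr hNM)
  have hφ : ContDiff ℝ (⊤ : ℕ∞) φ := φ.contMDiff.contDiff
  refine ⟨fun t => φ t • R t, M, ?_, hM, hKM.trans interior_subset, hMF, ?_, ?_⟩
  · refine contDiff_iff_contDiffAt.mpr fun s => ?_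
    by_cases hs : s ∈ K
    · refine (contDiffAt_const (c := (0 : X →L[ℂ] X))).congr_of_eventuallyEq ?_
      filter_upwards [isOpen_interior.mem_nhds (hKN hs)] with t ht
      have h0 : φ t = 0 := hφ0 (interior_subset ht)
      simp [h0]
    · exact hφ.contDiffAt.smul (hR_smooth s hs)
  · intro t ht
    have h1 : φ t = 1 := hφ1 fun h => ht (interior_subset h)
    simp [h1]
  · intro s x
    by_cases hs : s ∈ K
    · have h0 : φ s = 0 := hφ0 (interior_subset (hKN hs))
      simp [h0]
    · exact D.smul_of_tower_mem (φ s) (hR_mem s hs x)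
end

section
/- Let X be a complex Banach space and H ∈ C^∞(ℝ, L(X)) such that there exist b > 0, δ ∈ (1/2, 1) and constants η_k > 0 (k ∈ ℕ₀) with ‖H^{(k)}(s)‖ ≤ η_k |s|^{−(k+1)δ} for all |s| ≥ b and all k ∈ ℕ₀. Then: (i) for every t ∈ ℝ \ {0} the improper Riemann integral G(t) := (1/2π) lim_{S→−∞, T→∞} ∫_S^T H(s) e^{its} ds exists in L(X); (ii) H^{(k)} ∈ L¹(ℝ, L(X)) for every k ≥ 1; (iii) G(t) = (1/2π)(i/t)^k ∫_ℝ H^{(k)}(s) e^{its} ds for every k ∈ ℕ and t ≠ 0; (iv) G is continuous at every t ≠ 0 and G restricted to ℝ \ (−1, 1) is Bochner integrable. -/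
open MeasureTheory Filter Complex intervalIntegral

section FourierDecay

variable {E : Type*} [NormedAddCommGroup E] [NormedSpace ℂ E]

/-- The Fourier-type character `s ↦ e^{its}` has norm one. -/
lemma norm_exp_I_mul_ofReal_mul_ofReal (t s : ℝ) : ‖exp (I * t * s)‖ = 1 := by
  rw [show I * (t : ℂ) * s = ((t * s : ℝ) : ℂ) * I by push_cast; ring]
  exact norm_exp_ofReal_mul_I _

lemma hasDerivAt_exp_I_mul_smul {f : ℝ → E} {f' : E} {s : ℝ} (t : ℝ) (hf : HasDerivAt f f' s) :
    HasDerivAt (fun u : ℝ => exp (I * t * u) • f u)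
      (exp (I * t * s) • f' + (I * t) • exp (I * t * s) • f s) s := by
  have he : HasDerivAt (fun u : ℝ => exp (I * t * u)) (exp (I * t * s) * (I * t)) s := by
    have h : HasDerivAt (fun z : ℂ => I * t * z) (I * t) (s : ℂ) := by
      simpa using (hasDerivAt_id (s : ℂ)).const_mul (I * t)
    exact h.cexp.comp_ofReal
  have h := he.smul hf
  rwa [mul_comm (exp _), mul_smul] at h

lemma MeasureTheory.Integrable.exp_I_mul_smul {f : ℝ → E} (hf : Integrable f) (t : ℝ) :
    Integrable fun s : ℝ => exp (I * t * s) • f s :=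
  hf.bdd_smul 1 (Continuous.aestronglyMeasurable (by fun_prop))
    (Eventually.of_forall fun s => (norm_exp_I_mul_ofReal_mul_ofReal t s).le)

/-- Solving the integration by parts identity for the undifferentiated term. -/
lemma eq_I_div_smul_of_add_smul {t : ℝ} (ht : t ≠ 0) {x y z : E} (h : y + (I * t) • x = z) :
    x = (I / t) • (y - z) := by
  have htc : (t : ℂ) ≠ 0 := ofReal_ne_zero.2 ht
  rw [← h, sub_add_cancel_left, smul_neg, smul_smul,
    show I / (t : ℂ) * (I * t) = -1 by field_simp; exact I_sq]
  simp

/-- Integration by parts for the Fourier integral of an integrable function with integrable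
derivative. -/
lemma integral_exp_I_mul_smul_eq_of_hasDerivAt {f f' : ℝ → E} (hf : ∀ s, HasDerivAt f (f' s) s)
    (hfi : Integrable f) (hfi' : Integrable f') {t : ℝ} (ht : t ≠ 0) :
    ∫ s : ℝ, exp (I * t * s) • f s = (I / t) • ∫ s : ℝ, exp (I * t * s) • f' s := by
  have hsmul : Integrable fun s : ℝ => (I * t : ℂ) • exp (I * t * s) • f s :=
    (hfi.exp_I_mul_smul t).smul (I * t : ℂ)
  have h := integral_eq_zero_of_hasDerivAt_of_integrable
    (fun s => hasDerivAt_exp_I_mul_smul t (hf s))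
    ((hfi'.exp_I_mul_smul t).add hsmul) (hfi.exp_I_mul_smul t)
  rw [MeasureTheory.integral_add (hfi'.exp_I_mul_smul t) hsmul,
    MeasureTheory.integral_smul] at h
  simpa using eq_I_div_smul_of_add_smul ht h

/-- If `f` vanishes at infinity and has an integrable derivative, then its improper Fourier
integral converges away from zero. -/
lemma tendsto_intervalIntegral_exp_I_mul_smul [CompleteSpace E] {f f' : ℝ → E}
    (hf : ∀ s, HasDerivAt f (f' s) s) (hf0 : Tendsto f (cocompact ℝ) (nhds 0))
    (hfi' : Integrable f') {t : ℝ} (ht : t ≠ 0) :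
    Tendsto (fun p : ℝ × ℝ => ∫ s in p.1..p.2, exp (I * t * s) • f s) (atBot ×ˢ atTop)
      (nhds ((I / t) • ∫ s : ℝ, exp (I * t * s) • f' s)) := by
  have hcont : Continuous f := continuous_iff_continuousAt.2 fun s => (hf s).continuousAt
  have hparts (p : ℝ × ℝ) : ∫ s in p.1..p.2, exp (I * t * s) • f s =
      (I / t) • ((∫ s in p.1..p.2, exp (I * t * s) • f' s) -
        (exp (I * t * p.2) • f p.2 - exp (I * t * p.1) • f p.1)) := by
    have h₁ := (hfi'.exp_I_mul_smul t).intervalIntegrable (a := p.1) (b := p.2)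
    have h₂ : IntervalIntegrable (fun s : ℝ => exp (I * t * s) • f s) volume p.1 p.2 :=
      Continuous.intervalIntegrable (by fun_prop) _ _
    have h₃ : IntervalIntegrable (fun s : ℝ => (I * t : ℂ) • exp (I * t * s) • f s)
        volume p.1 p.2 := h₂.smul (I * t : ℂ)
    refine eq_I_div_smul_of_add_smul ht ?_
    rw [← integral_eq_sub_of_hasDerivAt (fun s _ => hasDerivAt_exp_I_mul_smul t (hf s))
      (h₁.add h₃), intervalIntegral.integral_add h₁ h₃,
      intervalIntegral.integral_smul]
  simp_rw [hparts]
  have hboundary : Tendsto (fun s : ℝ => exp (I * t * s) • f s) (cocompact ℝ) (nhds 0) := by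
    rw [tendsto_zero_iff_norm_tendsto_zero] at hf0 ⊢
    simpa [norm_smul, norm_exp_I_mul_ofReal_mul_ofReal] using hf0
  have htop := (hboundary.mono_left atTop_le_cocompact).comp
    (tendsto_snd (f := (atBot : Filter ℝ)) (g := (atTop : Filter ℝ)))
  have hbot := (hboundary.mono_left atBot_le_cocompact).comp
    (tendsto_fst (f := (atBot : Filter ℝ)) (g := (atTop : Filter ℝ)))
  have hint := intervalIntegral_tendsto_integral (hfi'.exp_I_mul_smul t)
    (tendsto_fst (f := (atBot : Filter ℝ)) (g := (atTop : Filter ℝ))) tendsto_snd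
  simpa using (hint.sub (htop.sub hbot)).const_smul (I / t)

lemma continuous_integral_exp_I_mul_smul {f : ℝ → E} (hf : Integrable f) :
    Continuous fun t : ℝ => ∫ s : ℝ, exp (I * t * s) • f s :=
  continuous_of_dominated (fun t => (hf.exp_I_mul_smul t).aestronglyMeasurable)
    (fun t => Eventually.of_forall fun s => by
      rw [norm_smul, norm_exp_I_mul_ofReal_mul_ofReal, one_mul]) hf.norm
    (Eventually.of_forall fun s => by fun_prop)

lemma norm_integral_exp_I_mul_smul_le (f : ℝ → E) (t : ℝ) :
    ‖∫ s : ℝ, exp (I * t * s) • f s‖ ≤ ∫ s, ‖f s‖ := by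
  refine (MeasureTheory.norm_integral_le_integral_norm _).trans_eq ?_
  simp [norm_smul, norm_exp_I_mul_ofReal_mul_ofReal]

end FourierDecay

/-- A continuous function on `ℝ` bounded by `C |s|^{-r}` with `r > 1` for large `|s|` is
integrable. -/
lemma integrable_of_norm_le_mul_abs_rpow {F : Type*} [NormedAddCommGroup F] {f : ℝ → F}
    (hf : Continuous f) {b C r : ℝ} (hr : 1 < r)
    (hbound : ∀ s, b ≤ |s| → ‖f s‖ ≤ C * |s| ^ (-r)) : Integrable f := by
  have hg : Integrable fun s : ℝ => (1 + ‖s‖) ^ (-r) := integrable_one_add_norm (by simpa using hr)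
  refine hf.locallyIntegrable.integrable_of_isBigO_cocompact ?_ (hg.integrableAtFilter _)
  refine Asymptotics.IsBigO.of_bound (|C| * 2 ^ r) ?_
  filter_upwards [(tendsto_norm_cocompact_atTop (E := ℝ)).eventually_ge_atTop (max b 1)] with s hs
  rw [Real.norm_eq_abs] at hs
  have hs1 : 1 ≤ |s| := (le_max_right _ _).trans hs
  have hcmp : |s| ^ (-r) ≤ 2 ^ r * (1 + |s|) ^ (-r) := by
    calc |s| ^ (-r) ≤ ((1 + |s|) / 2) ^ (-r) :=
          Real.rpow_le_rpow_of_nonpos (by positivity) (by linarith) (by linarith)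
      _ = 2 ^ r * (1 + |s|) ^ (-r) := by
          rw [Real.div_rpow (by positivity) (by norm_num), Real.rpow_neg zero_le_two,
            div_inv_eq_mul, mul_comm]
  rw [Real.norm_of_nonneg (by positivity), Real.norm_eq_abs]
  calc ‖f s‖ ≤ C * |s| ^ (-r) := hbound s ((le_max_left _ _).trans hs)
    _ ≤ |C| * (2 ^ r * (1 + |s|) ^ (-r)) :=
        mul_le_mul (le_abs_self C) hcmp (by positivity) (abs_nonneg C)
    _ = |C| * 2 ^ r * (1 + |s|) ^ (-r) := by ring

/-- A function on `ℝ` continuous away from zero and bounded by `C / t²` for `|t| ≥ 1` is integrable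
there. -/
lemma integrableOn_one_le_abs_of_norm_le_div_sq {F : Type*} [NormedAddCommGroup F] {f : ℝ → F}
    (hf : ∀ t, t ≠ 0 → ContinuousAt f t) {C : ℝ}
    (hbound : ∀ t, 1 ≤ |t| → ‖f t‖ ≤ C / t ^ 2) :
    IntegrableOn f {t : ℝ | 1 ≤ |t|} := by
  have hmeas : MeasurableSet {t : ℝ | 1 ≤ |t|} :=
    (isClosed_le continuous_const continuous_abs).measurableSet
  have hne (t : ℝ) (ht : 1 ≤ |t|) : t ≠ 0 := by
    rintro rfl
    norm_num at ht
  refine Integrable.mono' ((integrable_inv_one_add_sq.const_mul (|C| * 2)).integrableOn)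
    (ContinuousOn.aestronglyMeasurable
      (fun t ht => (hf t (hne t ht)).continuousWithinAt) hmeas) ?_
  refine (ae_restrict_iff' hmeas).2 (Eventually.of_forall fun t ht => ?_)
  have ht2 : 1 ≤ t ^ 2 := (one_le_sq_iff_one_le_abs t).2 ht
  calc ‖f t‖ ≤ C / t ^ 2 := hbound t ht
    _ ≤ |C| / t ^ 2 := by gcongr; exact le_abs_self C
    _ ≤ |C| * 2 * (1 + t ^ 2)⁻¹ := by
        rw [← div_eq_mul_inv, div_le_div_iff₀ (by positivity) (by positivity)]
        nlinarith [abs_nonneg C]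

/-- Let `H ∈ C^∞(ℝ, L(X))` with `‖H^{(k)}(s)‖ ≤ η_k |s|^{-(k+1)δ}`
for `|s| ≥ b`, where `b > 0`, `δ ∈ (1/2, 1)`, `η_k > 0`.  Then (i) for `t ≠ 0`
the improper Riemann integral `G(t) = (1/2π) ∫_ℝ H(s) e^{its} ds` exists,
(ii) `H^{(k)} ∈ L¹(ℝ, L(X))` for `k ≥ 1`,
(iii) `G(t) = (1/2π)(i/t)^k ∫_ℝ H^{(k)}(s) e^{its} ds` for `k ≥ 1`, `t ≠ 0`,
(iv) `G` is continuous away from `0` and integrable on `ℝ \ (-1, 1)`. -/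
theorem stmt8 {X : Type*} [NormedAddCommGroup X] [NormedSpace ℂ X] [CompleteSpace X]
    (H : ℝ → X →L[ℂ] X) (hH : ContDiff ℝ (⊤ : ℕ∞) H)
    (b δ : ℝ) (η : ℕ → ℝ) (hb : 0 < b) (hδ : 1 / 2 < δ ∧ δ < 1)
    (hη : ∀ k : ℕ, 0 < η k)
    (hbound : ∀ (k : ℕ) (s : ℝ), b ≤ |s| →
      ‖iteratedDeriv k H s‖ ≤ η k * |s| ^ (-(((k : ℝ) + 1) * δ))) :
    ∃ G : ℝ → X →L[ℂ] X,
      -- (i) the improper Riemann integral defining `G t` exists for `t ≠ 0`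
      (∀ t : ℝ, t ≠ 0 →
        Tendsto
          (fun p : ℝ × ℝ =>
            (1 / (2 * Real.pi)) • ∫ s in p.1..p.2, Complex.exp (Complex.I * t * s) • H s)
          (atBot ×ˢ atTop) (nhds (G t))) ∧
      -- (ii)
      (∀ k : ℕ, 1 ≤ k → Integrable (iteratedDeriv k H) (volume : Measure ℝ)) ∧
      -- (iii)
      (∀ (k : ℕ), 1 ≤ k → ∀ t : ℝ, t ≠ 0 →
        G t = ((1 / (2 * Real.pi) : ℂ) * (Complex.I / t) ^ k) •
          ∫ s : ℝ, Complex.exp (Complex.I * t * s) • iteratedDeriv k H s) ∧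
      -- (iv)
      (∀ t : ℝ, t ≠ 0 → ContinuousAt G t) ∧
      IntegrableOn G {t : ℝ | 1 ≤ |t|} (volume : Measure ℝ) := by
  have hdiff (k : ℕ) (s : ℝ) :
      HasDerivAt (iteratedDeriv k H) (iteratedDeriv (k + 1) H s) s := by
    rw [iteratedDeriv_succ]
    exact (hH.differentiable_iteratedDeriv k (by exact_mod_cast ENat.natCast_lt_top k) s).hasDerivAt
  have hint (k : ℕ) (hk : 1 ≤ k) : Integrable (iteratedDeriv k H) := by
    refine integrable_of_norm_le_mul_abs_rpow
      (continuous_iff_continuousAt.2 fun s => (hdiff k s).continuousAt) ?_ (hbound k)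
    have hk' : (1 : ℝ) ≤ k := by exact_mod_cast hk
    nlinarith [hδ.1]
  have hzero : Tendsto (iteratedDeriv 0 H) (cocompact ℝ) (nhds 0) := by
    have hpow := ((tendsto_rpow_neg_atTop (y := δ) (by linarith [hδ.1])).comp
      (tendsto_norm_cocompact_atTop (E := ℝ))).const_mul (η 0)
    rw [mul_zero] at hpow
    refine squeeze_zero_norm' ?_ hpow
    filter_upwards [(tendsto_norm_cocompact_atTop (E := ℝ)).eventually_ge_atTop b] with s hs
    simpa using hbound 0 s hs
  have hpow (k : ℕ) (t : ℝ) (ht : t ≠ 0) :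
      (I / t : ℂ) • ∫ s : ℝ, exp (I * t * s) • iteratedDeriv 1 H s =
        (I / t : ℂ) ^ (k + 1) • ∫ s : ℝ, exp (I * t * s) • iteratedDeriv (k + 1) H s := by
    induction k with
    | zero => simp
    | succ k ih =>
      rw [ih, integral_exp_I_mul_smul_eq_of_hasDerivAt (hdiff (k + 1)) (hint (k + 1) (by omega))
        (hint (k + 2) (by omega)) ht, smul_smul, ← pow_succ]
  let G : ℝ → X →L[ℂ] X := fun t => (1 / (2 * Real.pi) : ℂ) •
    (I / t : ℂ) • ∫ s : ℝ, exp (I * t * s) • iteratedDeriv 1 H s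
  have hG (k : ℕ) (hk : 1 ≤ k) (t : ℝ) (ht : t ≠ 0) :
      G t = ((1 / (2 * Real.pi) : ℂ) * (I / t) ^ k) •
        ∫ s : ℝ, exp (I * t * s) • iteratedDeriv k H s := by
    obtain ⟨k, rfl⟩ := Nat.exists_eq_add_of_le' hk
    simp only [G]
    rw [hpow k t ht, smul_smul]
  have hcont (t : ℝ) (ht : t ≠ 0) : ContinuousAt G t := by
    have hdiv : ContinuousAt (fun t : ℝ => I / (t : ℂ)) t :=
      continuousAt_const.div continuous_ofReal.continuousAt (ofReal_ne_zero.2 ht)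
    exact (hdiv.smul
      (continuous_integral_exp_I_mul_smul (hint 1 le_rfl)).continuousAt).const_smul
      (1 / (2 * Real.pi) : ℂ)
  refine ⟨G, fun t ht => ?_, hint, hG, hcont, ?_⟩
  · have h := (tendsto_intervalIntegral_exp_I_mul_smul (hdiff 0) hzero (hint 1 le_rfl)
      ht).const_smul (1 / (2 * Real.pi) : ℂ)
    refine h.congr fun p => ?_
    rw [iteratedDeriv_zero, show (1 / (2 * Real.pi) : ℂ) = ((1 / (2 * Real.pi) : ℝ) : ℂ) by
      push_cast; rfl]
    exact Complex.coe_smul (1 / (2 * Real.pi)) _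
  · refine integrableOn_one_le_abs_of_norm_le_div_sq hcont
      (C := 1 / (2 * Real.pi) * ∫ s, ‖iteratedDeriv 2 H s‖) fun t ht => ?_
    have ht0 : t ≠ 0 := by
      rintro rfl
      norm_num at ht
    rw [hG 2 one_le_two t ht0, norm_smul, mul_div_right_comm]
    refine mul_le_mul (le_of_eq ?_) (norm_integral_exp_I_mul_smul_le _ t) (norm_nonneg _)
      (by positivity)
    simp [abs_of_pos Real.pi_pos, div_eq_mul_inv]
end

section
/- Let X be a complex Banach space and H ∈ C^∞(ℝ, L(X)) such that there exist b > 0, δ ∈ (1/2, 1) and constants η_k > 0 (k ∈ ℕ₀) with ‖H^{(k)}(s)‖ ≤ η_k |s|^{−(k+1)δ} for all |s| ≥ b and all k ∈ ℕ₀, and such that H′(s) = −i H(s)² (composition of operators) for all |s| ≥ b. Then the function G defined for t ≠ 0 by the improper Riemann integral G(t) := (1/2π) lim_{S→−∞, T→∞} ∫_S^T H(s) e^{its} ds belongs to L¹(ℝ, L(X)). -/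
open MeasureTheory Filter Complex intervalIntegral

theorem norm_exp_I_mul_smul {E : Type*} [NormedAddCommGroup E] [NormedSpace ℂ E]
    (t s : ℝ) (v : E) : ‖Complex.exp (Complex.I * t * s) • v‖ = ‖v‖ := by
  rw [norm_smul, show Complex.I * t * s = ((t * s : ℝ) : ℂ) * Complex.I by push_cast; ring,
    Complex.norm_exp_ofReal_mul_I, one_mul]

/-- Integration by parts for an oscillatory integral. -/
theorem mul_integral_exp_smul_eq {E : Type*} [NormedAddCommGroup E] [NormedSpace ℂ E]
    [CompleteSpace E]
    {f f' : ℝ → E} (hf : ∀ s, HasDerivAt f (f' s) s)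
    (hf' : Continuous f') (t a b : ℝ) :
    (Complex.I * t) • ∫ s in a..b, Complex.exp (Complex.I * t * s) • f s =
      Complex.exp (Complex.I * t * b) • f b - Complex.exp (Complex.I * t * a) • f a -
        ∫ s in a..b, Complex.exp (Complex.I * t * s) • f' s := by
  have hcont : Continuous f := continuous_iff_continuousAt.2 fun s => (hf s).continuousAt
  have hexp (s : ℝ) : HasDerivAt (fun s : ℝ => Complex.exp (Complex.I * t * s))
      (Complex.exp (Complex.I * t * s) * (Complex.I * t)) s := by
    simpa using (((hasDerivAt_id (s : ℂ)).const_mul (Complex.I * t)).cexp).comp_ofReal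
  rw [integral_smul_deriv_eq_deriv_smul (fun s _ => hexp s) (fun s _ => hf s)
    (Continuous.intervalIntegrable (by fun_prop) _ _) (hf'.intervalIntegrable _ _),
    sub_sub_cancel, ← intervalIntegral.integral_smul]
  refine integral_congr fun s _ => ?_
  simp only [smul_smul]
  rw [mul_comm]

theorem abs_mul_norm_integral_exp_smul_le {E : Type*} [NormedAddCommGroup E] [NormedSpace ℂ E]
    [CompleteSpace E]
    {f f' : ℝ → E} (hf : ∀ s, HasDerivAt f (f' s) s)
    (hf' : Continuous f') (t a b : ℝ) :
    |t| * ‖∫ s in a..b, Complex.exp (Complex.I * t * s) • f s‖ ≤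
      ‖f a‖ + ‖f b‖ + ‖∫ s in a..b, Complex.exp (Complex.I * t * s) • f' s‖ := by
  have h := congrArg norm (mul_integral_exp_smul_eq hf hf' t a b)
  rw [norm_smul, norm_mul, Complex.norm_I, one_mul, Complex.norm_real, Real.norm_eq_abs] at h
  rw [h]
  refine (norm_sub_le _ _).trans (add_le_add_left ((norm_sub_le _ _).trans ?_) _)
  rw [norm_exp_I_mul_smul, norm_exp_I_mul_smul, add_comm]

/-- A half-line oscillatory integral of a function with symbol-like decay is controlled by
splitting at the scale `|t|⁻¹`. -/
theorem norm_integral_zero_exp_smul_le {E : Type*} [NormedAddCommGroup E] [NormedSpace ℂ E]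
    [CompleteSpace E]
    {f f' : ℝ → E} (hf : ∀ s, HasDerivAt f (f' s) s)
    (hf' : Continuous f') {δ A B : ℝ} (hδ : 1 / 2 < δ) (hδ' : δ < 1)
    (hA : ∀ s, 0 < s → ‖f s‖ ≤ A * s ^ (-δ)) (hB : ∀ s, 0 < s → ‖f' s‖ ≤ B * s ^ (-(2 * δ)))
    {t T : ℝ} (ht : t ≠ 0) (hT : |t|⁻¹ ≤ T) :
    ‖∫ s in (0 : ℝ)..T, Complex.exp (Complex.I * t * s) • f s‖ ≤
      (A / (1 - δ) + 2 * A) * |t| ^ (δ - 1) + B / (2 * δ - 1) * |t| ^ (2 * δ - 2) := by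
  have hcont : Continuous f := continuous_iff_continuousAt.2 fun s => (hf s).continuousAt
  have hpos : 0 < |t| := abs_pos.2 ht
  have hR : 0 < |t|⁻¹ := inv_pos.2 hpos
  have hA0 : 0 ≤ A := by simpa using (norm_nonneg _).trans (hA 1 one_pos)
  have hB0 : 0 ≤ B := by simpa using (norm_nonneg _).trans (hB 1 one_pos)
  have hint (a b : ℝ) : IntervalIntegrable
      (fun s : ℝ => Complex.exp (Complex.I * t * s) • f s) volume a b :=
    Continuous.intervalIntegrable (by fun_prop) _ _
  have hnear : ‖∫ s in (0 : ℝ)..|t|⁻¹, Complex.exp (Complex.I * t * s) • f s‖ ≤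
      A / (1 - δ) * |t| ^ (δ - 1) := by
    calc _ ≤ ∫ s in (0 : ℝ)..|t|⁻¹, A * s ^ (-δ) := by
          refine norm_integral_le_of_norm_le hR.le (ae_of_all _ fun s hs => ?_)
            ((intervalIntegrable_rpow' (by linarith)).const_mul _)
          rw [norm_exp_I_mul_smul]
          exact hA s hs.1
      _ = _ := by
          rw [intervalIntegral.integral_const_mul, integral_rpow (Or.inl (by linarith)),
            Real.zero_rpow (by linarith), Real.inv_rpow hpos.le, ← Real.rpow_neg hpos.le]
          ring_nf
  have hfar : ‖∫ s in |t|⁻¹..T, Complex.exp (Complex.I * t * s) • f' s‖ ≤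
      B / (2 * δ - 1) * |t| ^ (2 * δ - 1) := by
    have hzero : (0 : ℝ) ∉ Set.uIcc |t|⁻¹ T := by
      rw [Set.uIcc_of_le hT]
      exact fun h => hR.not_ge h.1
    calc _ ≤ ∫ s in |t|⁻¹..T, B * s ^ (-(2 * δ)) := by
          refine norm_integral_le_of_norm_le hT (ae_of_all _ fun s hs => ?_)
            ((intervalIntegrable_rpow (Or.inr hzero)).const_mul _)
          rw [norm_exp_I_mul_smul]
          exact hB s (hR.trans hs.1)
      _ = B / (2 * δ - 1) * (|t|⁻¹ ^ (-(2 * δ - 1)) - T ^ (-(2 * δ - 1))) := by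
          rw [intervalIntegral.integral_const_mul,
            integral_rpow (Or.inr ⟨by linarith, hzero⟩),
            show -(2 * δ) + 1 = -(2 * δ - 1) by ring]
          have : 2 * δ - 1 ≠ 0 := by linarith
          field_simp
          ring
      _ ≤ B / (2 * δ - 1) * |t|⁻¹ ^ (-(2 * δ - 1)) := by
          have : 0 < 2 * δ - 1 := by linarith
          have : 0 ≤ T ^ (-(2 * δ - 1)) := Real.rpow_nonneg (hR.le.trans hT) _
          gcongr
          linarith
      _ = _ := by rw [Real.inv_rpow hpos.le, ← Real.rpow_neg hpos.le, neg_neg]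
  have hRδ : |t|⁻¹ ^ (-δ) = |t| ^ δ := by
    rw [Real.inv_rpow hpos.le, ← Real.rpow_neg hpos.le, neg_neg]
  have hends : ‖f |t|⁻¹‖ + ‖f T‖ ≤ 2 * A * |t| ^ δ := by
    have h1 := hA _ hR
    have h2 : ‖f T‖ ≤ A * |t|⁻¹ ^ (-δ) := (hA T (hR.trans_le hT)).trans <| by
      gcongr A * ?_
      exact Real.rpow_le_rpow_of_nonpos hR hT (by linarith)
    rw [hRδ] at h1 h2
    linarith
  have htail : ‖∫ s in |t|⁻¹..T, Complex.exp (Complex.I * t * s) • f s‖ ≤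
      2 * A * |t| ^ (δ - 1) + B / (2 * δ - 1) * |t| ^ (2 * δ - 2) := by
    have h := (abs_mul_norm_integral_exp_smul_le hf hf' t |t|⁻¹ T).trans (add_le_add hends hfar)
    rw [mul_comm, ← le_div_iff₀ hpos] at h
    refine h.trans_eq ?_
    rw [show 2 * δ - 2 = 2 * δ - 1 - 1 by ring, Real.rpow_sub_one hpos.ne' δ,
      Real.rpow_sub_one hpos.ne' (2 * δ - 1)]
    ring
  rw [← integral_add_adjacent_intervals (hint 0 |t|⁻¹) (hint |t|⁻¹ T)]
  refine (norm_add_le _ _).trans ((add_le_add hnear htail).trans_eq ?_)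
  ring

/-- The whole-line analogue of `norm_integral_zero_exp_smul_le`. -/
theorem norm_integral_exp_smul_le_rpow {E : Type*} [NormedAddCommGroup E] [NormedSpace ℂ E]
    [CompleteSpace E]
    {f f' : ℝ → E} (hf : ∀ s, HasDerivAt f (f' s) s)
    (hf' : Continuous f') {δ A B : ℝ} (hδ : 1 / 2 < δ) (hδ' : δ < 1)
    (hA : ∀ s, s ≠ 0 → ‖f s‖ ≤ A * |s| ^ (-δ))
    (hB : ∀ s, s ≠ 0 → ‖f' s‖ ≤ B * |s| ^ (-(2 * δ)))
    {t S T : ℝ} (ht : t ≠ 0) (hS : S ≤ -|t|⁻¹) (hT : |t|⁻¹ ≤ T) :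
    ‖∫ s in S..T, Complex.exp (Complex.I * t * s) • f s‖ ≤
      2 * ((A / (1 - δ) + 2 * A) * |t| ^ (δ - 1) + B / (2 * δ - 1) * |t| ^ (2 * δ - 2)) := by
  have hcont : Continuous f := continuous_iff_continuousAt.2 fun s => (hf s).continuousAt
  have hint (a b : ℝ) : IntervalIntegrable
      (fun s : ℝ => Complex.exp (Complex.I * t * s) • f s) volume a b :=
    Continuous.intervalIntegrable (by fun_prop) _ _
  have hpos := norm_integral_zero_exp_smul_le hf hf' hδ hδ'
    (fun s hs => by simpa [abs_of_pos hs] using hA s hs.ne')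
    (fun s hs => by simpa [abs_of_pos hs] using hB s hs.ne') ht hT
  have hneg := norm_integral_zero_exp_smul_le (f := fun s => f (-s)) (f' := fun s => -f' (-s))
    (fun s => by simpa [Function.comp_def] using (hf (-s)).scomp s (hasDerivAt_neg s)) (by fun_prop) hδ hδ'
    (fun s hs => by simpa [abs_of_pos hs] using hA (-s) (neg_ne_zero.2 hs.ne'))
    (fun s hs => by simpa [abs_of_pos hs] using hB (-s) (neg_ne_zero.2 hs.ne'))
    (t := -t) (T := -S) (neg_ne_zero.2 ht) (by rw [abs_neg]; linarith)
  have hrefl : ∫ s in (0 : ℝ)..-S, Complex.exp (Complex.I * (-t : ℝ) * s) • f (-s) =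
      ∫ s in S..0, Complex.exp (Complex.I * t * s) • f s := by
    have := integral_comp_neg (a := 0) (b := -S)
      (fun s : ℝ => Complex.exp (Complex.I * t * s) • f s)
    rw [neg_neg, neg_zero] at this
    rw [← this]
    refine integral_congr fun s _ => ?_
    simp
  rw [hrefl, abs_neg] at hneg
  rw [← integral_add_adjacent_intervals (hint S 0) (hint 0 T)]
  refine (norm_add_le _ _).trans ((add_le_add hneg hpos).trans_eq ?_)
  ring

/-- Power decay outside a bounded set upgrades to a global bound for a continuous function. -/
theorem Continuous.exists_norm_le_one_add_abs_rpow {E : Type*} [NormedAddCommGroup E]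
    {f : ℝ → E} (hf : Continuous f)
    {b r C : ℝ} (hb : 0 < b) (hr : 0 ≤ r) (hC : 0 ≤ C)
    (hbound : ∀ s, b ≤ |s| → ‖f s‖ ≤ C * |s| ^ (-r)) :
    ∃ A, 0 ≤ A ∧ ∀ s, ‖f s‖ ≤ A * (1 + |s|) ^ (-r) := by
  obtain ⟨K, hK⟩ := (isCompact_Icc (a := -b) (b := b)).exists_bound_of_continuousOn
    hf.continuousOn
  have hK0 : 0 ≤ K := (norm_nonneg _).trans (hK 0 ⟨by linarith, hb.le⟩)
  refine ⟨K * (1 + b) ^ r + C * (1 + b⁻¹) ^ r, by positivity, fun s => ?_⟩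
  rw [add_mul]
  rcases le_total |s| b with hs | hs
  · have h1 := hK s (abs_le.1 hs)
    have h2 : 1 ≤ (1 + b) ^ r * (1 + |s|) ^ (-r) := by
      rw [Real.rpow_neg (by positivity), ← div_eq_mul_inv, one_le_div (by positivity)]
      gcongr
    have h3 : 0 ≤ C * (1 + b⁻¹) ^ r * (1 + |s|) ^ (-r) := by positivity
    nlinarith
  · have hs0 : 0 < |s| := hb.trans_le hs
    have h2 : |s| ^ (-r) ≤ (1 + b⁻¹) ^ r * (1 + |s|) ^ (-r) := by
      rw [Real.rpow_neg hs0.le, Real.rpow_neg (by positivity), ← div_eq_mul_inv,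
        le_div_iff₀ (by positivity), ← Real.inv_rpow hs0.le,
        ← Real.mul_rpow (by positivity) (by positivity)]
      gcongr
      rw [mul_add, inv_mul_cancel₀ hs0.ne', mul_one, add_comm]
      gcongr
    have h3 : 0 ≤ K * (1 + b) ^ r * (1 + |s|) ^ (-r) := by positivity
    nlinarith [hbound s hs, mul_le_mul_of_nonneg_left h2 hC]

theorem intervalIntegrable_abs_rpow {r : ℝ} (hr : -1 < r) :
    IntervalIntegrable (fun x : ℝ => |x| ^ r) volume (-1) 1 := by
  have h : IntervalIntegrable (fun x : ℝ => |x| ^ r) volume 0 1 :=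
    (intervalIntegrable_rpow' hr).congr fun x hx => by
      rw [Set.uIoc_of_le zero_le_one] at hx
      simp only [abs_of_pos hx.1]
  refine IntervalIntegrable.trans (b := 0) ?_ h
  simpa using ((IntervalIntegrable.iff_comp_neg).1 h).symm

theorem integrable_of_norm_le_rpow_of_norm_le_inv_sq {E : Type*} [NormedAddCommGroup E]
    {G : ℝ → E} (hG : AEStronglyMeasurable G)
    {p q A B C : ℝ} (hp : -1 < p) (hq : -1 < q)
    (hsmall : ∀ t, t ≠ 0 → ‖G t‖ ≤ A * |t| ^ p + B * |t| ^ q)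
    (hlarge : ∀ t, t ≠ 0 → ‖G t‖ ≤ C * (|t| ^ 2)⁻¹) :
    Integrable G := by
  have hC : 0 ≤ C := by simpa using (norm_nonneg _).trans (hlarge 1 one_ne_zero)
  rw [← integrableOn_univ, ← Set.union_compl_self (Set.Ioc (-1 : ℝ) 1)]
  refine IntegrableOn.union ?_ ?_
  · refine Integrable.mono' (g := fun t => A * |t| ^ p + B * |t| ^ q) ?_ hG.restrict
      (ae_restrict_of_ae ((Measure.ae_ne volume 0).mono hsmall))
    have := ((intervalIntegrable_abs_rpow hp).const_mul A).add
      ((intervalIntegrable_abs_rpow hq).const_mul B)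
    exact (intervalIntegrable_iff_integrableOn_Ioc_of_le (by norm_num)).1 this
  · have hdom : Integrable (fun t : ℝ => C * 4 * (1 + ‖t‖) ^ (-2 : ℝ)) :=
      (integrable_one_add_norm (by simp)).const_mul _
    refine Integrable.mono' hdom.integrableOn hG.restrict
      ((ae_restrict_iff' measurableSet_Ioc.compl).2 (ae_of_all _ fun t ht => ?_))
    have ht1 : 1 ≤ |t| := by
      by_contra! h
      exact ht ⟨(abs_lt.1 h).1, (abs_lt.1 h).2.le⟩
    refine (hlarge t (by rintro rfl; simp at ht1; linarith)).trans ?_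
    rw [mul_assoc]
    refine mul_le_mul_of_nonneg_left ?_ hC
    rw [Real.norm_eq_abs, Real.rpow_neg (by positivity), Real.rpow_two,
      ← div_eq_mul_inv, inv_eq_one_div, div_le_div_iff₀ (by positivity) (by positivity)]
    nlinarith

theorem aestronglyMeasurable_of_tendsto_integral_exp_smul {E : Type*} [NormedAddCommGroup E]
    [NormedSpace ℂ E] {H : ℝ → E} (hH : Continuous H) {c : ℝ} {G : ℝ → E}
    (hG : ∀ t : ℝ, t ≠ 0 →
      Tendsto
        (fun p : ℝ × ℝ => c • ∫ s in p.1..p.2, Complex.exp (Complex.I * t * s) • H s)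
        (atBot ×ˢ atTop) (nhds (G t))) :
    AEStronglyMeasurable G := by
  have hcut : Tendsto (fun n : ℕ => ((-n : ℝ), (n : ℝ))) atTop (atBot ×ˢ atTop) :=
    (tendsto_neg_atTop_atBot.comp tendsto_natCast_atTop_atTop).prodMk tendsto_natCast_atTop_atTop
  refine aestronglyMeasurable_of_tendsto_ae atTop
    (f := fun (n : ℕ) (t : ℝ) => c •
      ∫ s in (-n : ℝ)..n, Complex.exp (Complex.I * t * s) • H s) (fun n => ?_)
    ((Measure.ae_ne volume 0).mono fun t ht => ?_)
  · refine Continuous.aestronglyMeasurable (Continuous.fun_const_smul ?_ _)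
    refine continuous_parametric_intervalIntegral_of_continuous' ?_ _ _
    fun_prop
  · exact (hG t ht).comp hcut

/-- The improper inverse Fourier integral of a smooth function with symbol-like decay of type
`δ ∈ (1/2, 1)` is integrable. -/
theorem integrable_improper_fourierIntegral_of_decay {E : Type*} [NormedAddCommGroup E]
    [NormedSpace ℂ E] [CompleteSpace E] {H : ℝ → E} (hH : ContDiff ℝ (⊤ : ℕ∞) H)
    {b δ : ℝ} {η : ℕ → ℝ} (hb : 0 < b) (hδ : 1 / 2 < δ ∧ δ < 1) (hη : ∀ k : ℕ, 0 < η k)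
    (hbound : ∀ (k : ℕ) (s : ℝ), b ≤ |s| →
      ‖iteratedDeriv k H s‖ ≤ η k * |s| ^ (-(((k : ℝ) + 1) * δ)))
    {G : ℝ → E}
    (hG : ∀ t : ℝ, t ≠ 0 →
      Tendsto
        (fun p : ℝ × ℝ =>
          (1 / (2 * Real.pi)) • ∫ s in p.1..p.2, Complex.exp (Complex.I * t * s) • H s)
        (atBot ×ˢ atTop) (nhds (G t))) :
    Integrable G := by
  obtain ⟨hδ1, hδ2⟩ := hδ
  have hcont (k : ℕ) : Continuous (iteratedDeriv k H) :=
    hH.continuous_iteratedDeriv k (by exact_mod_cast le_top)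
  have hderiv (k : ℕ) (s : ℝ) :
      HasDerivAt (iteratedDeriv k H) (iteratedDeriv (k + 1) H s) s := by
    rw [iteratedDeriv_succ]
    exact (hH.differentiable_iteratedDeriv k
      (by exact_mod_cast WithTop.coe_lt_top k) s).hasDerivAt
  have hderiv0 (s : ℝ) : HasDerivAt H (iteratedDeriv 1 H s) s := by
    simpa using hderiv 0 s
  have hdecay (k : ℕ) := (hcont k).exists_norm_le_one_add_abs_rpow hb
    (r := ((k : ℝ) + 1) * δ) (by positivity) (hη k).le (hbound k)
  choose A hA0 hA using hdecay
  have hAabs (k : ℕ) (s : ℝ) (hs : s ≠ 0) :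
      ‖iteratedDeriv k H s‖ ≤ A k * |s| ^ (-(((k : ℝ) + 1) * δ)) := by
    refine (hA k s).trans (mul_le_mul_of_nonneg_left ?_ (hA0 k))
    refine Real.rpow_le_rpow_of_nonpos (abs_pos.2 hs) (by linarith) ?_
    have : 0 ≤ ((k : ℝ) + 1) * δ := by positivity
    linarith
  have hint : Integrable (fun s : ℝ => A 2 * (1 + ‖s‖) ^ (-(((2 : ℕ) + 1 : ℝ) * δ))) :=
    (integrable_one_add_norm (by norm_num; linarith)).const_mul _
  have hint2 : Integrable (iteratedDeriv 2 H) :=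
    hint.mono' (hcont 2).aestronglyMeasurable (ae_of_all _ (hA 2))
  have hπ : ‖(1 / (2 * Real.pi) : ℝ)‖ ≤ 1 := by
    rw [Real.norm_of_nonneg (by positivity), div_le_one (by positivity)]
    linarith [Real.pi_gt_three]
  have hpibound (v : E) : ‖(1 / (2 * Real.pi)) • v‖ ≤ ‖v‖ := by
    rw [norm_smul]
    exact mul_le_of_le_one_left (norm_nonneg _) hπ
  refine integrable_of_norm_le_rpow_of_norm_le_inv_sq
    (aestronglyMeasurable_of_tendsto_integral_exp_smul hH.continuous hG)
    (p := δ - 1) (q := 2 * δ - 2)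
    (A := 2 * (A 0 / (1 - δ) + 2 * A 0)) (B := 2 * (A 1 / (2 * δ - 1)))
    (C := ∫ s, ‖iteratedDeriv 2 H s‖) (by linarith) (by linarith) (fun t ht => ?_) (fun t ht => ?_)
  · refine le_of_tendsto (hG t ht).norm ?_
    filter_upwards [prod_mem_prod (Iic_mem_atBot (-|t|⁻¹)) (Ici_mem_atTop |t|⁻¹)] with p hp
    refine (hpibound _).trans ((norm_integral_exp_smul_le_rpow hderiv0 (hcont 1) hδ1 hδ2
      (A := A 0) (B := A 1) (fun s hs => by simpa using hAabs 0 s hs)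
      (fun s hs => ?_) ht hp.1 hp.2).trans_eq (by ring))
    have := hAabs 1 s hs
    norm_num at this
    simpa using this
  · have hzero (k : ℕ) (l : Filter ℝ) (hl : Tendsto (fun s : ℝ => |s|) l atTop) :
        Tendsto (fun s => ‖iteratedDeriv k H s‖) l (nhds 0) := by
      have h := ((tendsto_rpow_neg_atTop (y := ((k : ℝ) + 1) * δ) (by positivity)).comp
        hl).const_mul (A k)
      rw [mul_zero] at h
      refine squeeze_zero' (Eventually.of_forall fun s => norm_nonneg _) ?_ h
      filter_upwards [hl.eventually_gt_atTop 0] with s hs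
      exact hAabs k s (abs_pos.1 hs)
    have hpos : 0 < |t| := abs_pos.2 ht
    have hends (k : ℕ) : Tendsto (fun p : ℝ × ℝ =>
        ‖iteratedDeriv k H p.1‖ + ‖iteratedDeriv k H p.2‖) (atBot ×ˢ atTop) (nhds 0) := by
      simpa using ((hzero k _ tendsto_abs_atBot_atTop).comp tendsto_fst).add
        ((hzero k _ tendsto_abs_atTop_atTop).comp tendsto_snd)
    have hlim : Tendsto (fun p : ℝ × ℝ =>
        (‖iteratedDeriv 0 H p.1‖ + ‖iteratedDeriv 0 H p.2‖ +
          (‖iteratedDeriv 1 H p.1‖ + ‖iteratedDeriv 1 H p.2‖ +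
            ∫ s, ‖iteratedDeriv 2 H s‖) / |t|) / |t|) (atBot ×ˢ atTop)
        (nhds ((0 + (0 + ∫ s, ‖iteratedDeriv 2 H s‖) / |t|) / |t|)) :=
      ((hends 0).add (((hends 1).add_const _).div_const _)).div_const _
    have heq : (0 + (0 + ∫ s, ‖iteratedDeriv 2 H s‖) / |t|) / |t| =
        (∫ s, ‖iteratedDeriv 2 H s‖) * (|t| ^ 2)⁻¹ := by
      rw [zero_add, zero_add, div_div, ← sq, div_eq_mul_inv]
    rw [heq] at hlim
    refine le_of_tendsto_of_tendsto (hG t ht).norm hlim ?_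
    filter_upwards [prod_mem_prod (Iic_mem_atBot (0 : ℝ)) (Ici_mem_atTop (0 : ℝ))] with p hp
    have h0 := abs_mul_norm_integral_exp_smul_le hderiv0 (hcont 1) t p.1 p.2
    have h1 := abs_mul_norm_integral_exp_smul_le (hderiv 1) (hcont 2) t p.1 p.2
    have h2 : ‖∫ s in p.1..p.2, Complex.exp (Complex.I * t * s) • iteratedDeriv 2 H s‖ ≤
        ∫ s, ‖iteratedDeriv 2 H s‖ := by
      rw [integral_of_le (le_trans hp.1 hp.2)]
      refine (MeasureTheory.norm_integral_le_integral_norm _).trans ?_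
      simp only [norm_exp_I_mul_smul]
      exact setIntegral_le_integral hint2.norm (ae_of_all _ fun _ => norm_nonneg _)
    refine (hpibound _).trans ?_
    rw [le_div_iff₀ hpos, mul_comm]
    refine h0.trans ?_
    rw [iteratedDeriv_zero]
    gcongr
    rw [le_div_iff₀ hpos, mul_comm]
    exact h1.trans (by gcongr)

/-- Let `H ∈ C^∞(ℝ, L(X))` with `‖H^{(k)}(s)‖ ≤ η_k |s|^{-(k+1)δ}`
for `|s| ≥ b` (`b > 0`, `δ ∈ (1/2, 1)`, `η_k > 0`) and `H'(s) = -i H(s)²` for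
`|s| ≥ b`.  Then the function `G` defined for `t ≠ 0` by the improper Riemann
integral `G(t) = (1/2π) ∫_ℝ H(s) e^{its} ds` belongs to `L¹(ℝ, L(X))`. -/
theorem stmt9 {X : Type*} [NormedAddCommGroup X] [NormedSpace ℂ X] [CompleteSpace X]
    (H : ℝ → X →L[ℂ] X) (hH : ContDiff ℝ (⊤ : ℕ∞) H)
    (b δ : ℝ) (η : ℕ → ℝ) (hb : 0 < b) (hδ : 1 / 2 < δ ∧ δ < 1)
    (hη : ∀ k : ℕ, 0 < η k)
    (hbound : ∀ (k : ℕ) (s : ℝ), b ≤ |s| →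
      ‖iteratedDeriv k H s‖ ≤ η k * |s| ^ (-(((k : ℝ) + 1) * δ)))
    (hH' : ∀ s : ℝ, b ≤ |s| → deriv H s = (-Complex.I) • (H s * H s))
    (G : ℝ → X →L[ℂ] X)
    (hG : ∀ t : ℝ, t ≠ 0 →
      Tendsto
        (fun p : ℝ × ℝ =>
          (1 / (2 * Real.pi)) • ∫ s in p.1..p.2, Complex.exp (Complex.I * t * s) • H s)
        (atBot ×ˢ atTop) (nhds (G t))) :
    Integrable G (volume : Measure ℝ) := by
  exact integrable_improper_fourierIntegral_of_decay hH hb hδ hη hbound hG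
end

section
/- Let X be a complex Banach space and H ∈ C^∞(ℝ, L(X)) such that there exist b > 0, δ ∈ (1/2, 1) and constants η_k > 0 (k ∈ ℕ₀) with ‖H^{(k)}(s)‖ ≤ η_k |s|^{−(k+1)δ} for all |s| ≥ b and all k ∈ ℕ₀, and such that H′(s) = −i H(s)² for all |s| ≥ b. Let G ∈ L¹(ℝ, L(X)) be defined for t ≠ 0 by G(t) := (1/2π) lim_{S→−∞, T→∞} ∫_S^T H(s) e^{its} ds. Then the Fourier transform of G recovers H: Ĝ(λ) := ∫_ℝ G(t) e^{−iλt} dt = H(λ) for every λ ∈ ℝ. -/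
open MeasureTheory Filter Complex intervalIntegral

section FourierAux

open scoped FourierTransform Topology

variable {E : Type*} [NormedAddCommGroup E]

/-- A continuous function dominated by `|s| ^ (-p)` with `p > 1` away from a bounded interval is
integrable. -/
lemma Continuous.integrable_of_norm_le_rpow_abs {f : ℝ → E} (hf : Continuous f) {b p C : ℝ}
    (hb : 0 < b) (hp : 1 < p) (hC : 0 ≤ C) (h : ∀ s : ℝ, b ≤ |s| → ‖f s‖ ≤ C * |s| ^ (-p)) :
    Integrable f := by
  have hg : Integrable (fun s : ℝ => (1 + ‖s‖) ^ (-p)) :=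
    integrable_one_add_norm (by simpa using hp)
  refine hf.locallyIntegrable.integrable_of_isBigO_cocompact (g := fun s : ℝ => (1 + ‖s‖) ^ (-p))
    ?_ (hg.integrableAtFilter _)
  set c := b / (1 + b) with hc
  have hc0 : 0 < c := by positivity
  refine Asymptotics.IsBigO.of_bound (C * c ^ (-p)) ?_
  filter_upwards [(tendsto_norm_cocompact_atTop (E := ℝ)).eventually_ge_atTop b] with s hs
  rw [Real.norm_eq_abs] at hs
  have hle : (1 + |s|) * c ≤ |s| := by
    rw [hc, mul_div_assoc', div_le_iff₀ (by positivity)]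
    nlinarith
  have hpow : |s| ^ (-p) ≤ (1 + |s|) ^ (-p) * c ^ (-p) := by
    rw [← Real.mul_rpow (by positivity) hc0.le]
    exact Real.rpow_le_rpow_of_nonpos (by positivity) hle (by linarith)
  rw [Real.norm_of_nonneg (by positivity : 0 ≤ (1 + ‖s‖) ^ (-p)), Real.norm_eq_abs]
  calc ‖f s‖ ≤ C * |s| ^ (-p) := h s hs
    _ ≤ C * ((1 + |s|) ^ (-p) * c ^ (-p)) := by gcongr
    _ = C * c ^ (-p) * (1 + |s|) ^ (-p) := by ring

variable [NormedSpace ℂ E]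

lemma MeasureTheory.Integrable.continuous_fourier {f : ℝ → E} (hf : Integrable f) :
    Continuous (𝓕 f) :=
  VectorFourier.fourierIntegral_continuous Real.continuous_fourierChar
    (by exact continuous_inner) hf

lemma Real.norm_fourier_le_integral_norm (f : ℝ → E) (w : ℝ) : ‖𝓕 f w‖ ≤ ∫ v, ‖f v‖ :=
  VectorFourier.norm_fourierIntegral_le_integral_norm _ _ _ _ _

/-- The Fourier transform of a twice differentiable function with integrable derivatives up to
order two is integrable. -/
lemma MeasureTheory.Integrable.fourier_of_deriv_deriv {f : ℝ → E} (hf : Integrable f)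
    (hd : Differentiable ℝ f) (hf' : Integrable (deriv f)) (hd' : Differentiable ℝ (deriv f))
    (hf'' : Integrable (deriv (deriv f))) : Integrable (𝓕 f) := by
  set A := ∫ v, ‖f v‖
  set B := ∫ v, ‖deriv (deriv f) v‖
  refine (integrable_inv_one_add_sq.const_mul (A + B)).mono'
    hf.continuous_fourier.aestronglyMeasurable (Eventually.of_forall fun x => ?_)
  have hA : ‖𝓕 f x‖ ≤ A := Real.norm_fourier_le_integral_norm f x
  have hB : ‖𝓕 (deriv (deriv f)) x‖ ≤ B := Real.norm_fourier_le_integral_norm _ x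
  rw [Real.fourier_deriv hf' hd' hf'', Real.fourier_deriv hf hd hf'] at hB
  simp only [norm_smul, norm_mul, Complex.norm_ofNat, Complex.norm_real, Complex.norm_I, mul_one,
    Real.norm_eq_abs, abs_of_pos Real.pi_pos] at hB
  rw [← div_eq_mul_inv, le_div_iff₀ (by positivity)]
  have hpi : 1 ≤ 2 * Real.pi := by linarith [Real.pi_gt_three]
  have hx : x ^ 2 ≤ 2 * Real.pi * |x| * (2 * Real.pi * |x|) := by
    rw [← sq_abs x]
    nlinarith [mul_le_mul_of_nonneg_right hpi (abs_nonneg x), abs_nonneg x]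
  nlinarith [mul_le_mul_of_nonneg_right hx (norm_nonneg (𝓕 f x))]

/-- Integration by parts for the improper Fourier integral of a function vanishing at infinity
whose derivative is integrable. -/
lemma tendsto_intervalIntegral_exp_smul [CompleteSpace E] {f : ℝ → E} (hf : ContDiff ℝ 1 f)
    (hf' : Integrable (deriv f)) (h0 : Tendsto f (cocompact ℝ) (𝓝 0)) {t : ℝ} (ht : t ≠ 0) :
    Tendsto (fun p : ℝ × ℝ => ∫ s in p.1..p.2, Complex.exp (Complex.I * t * s) • f s)
      (atBot ×ˢ atTop)
      (𝓝 (-((Complex.I * t)⁻¹ • ∫ s : ℝ, Complex.exp (Complex.I * t * s) • deriv f s))) := by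
  have hIt : Complex.I * t ≠ 0 := mul_ne_zero Complex.I_ne_zero (by exact_mod_cast ht)
  have hnorm : ∀ s : ℝ, ‖Complex.exp (Complex.I * t * s)‖ = 1 := fun s => by
    rw [show Complex.I * t * s = ((t * s : ℝ) : ℂ) * Complex.I by push_cast; ring,
      Complex.norm_exp_ofReal_mul_I]
  have hcont : Continuous fun s : ℝ => Complex.exp (Complex.I * t * s) := by fun_prop
  have hexp : ∀ s : ℝ, HasDerivAt (fun s : ℝ => (Complex.I * t)⁻¹ * Complex.exp (Complex.I * t * s))
      (Complex.exp (Complex.I * t * s)) s := fun s => by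
    have := (((hasDerivAt_id (s : ℂ)).const_mul (Complex.I * t)).cexp.const_mul
      (Complex.I * t)⁻¹).comp_ofReal
    rwa [mul_one, mul_comm (Complex.exp _), inv_mul_cancel_left₀ hIt] at this
  have hd : ∀ s : ℝ, HasDerivAt f (deriv f s) s := fun s =>
    (hf.differentiable one_ne_zero s).hasDerivAt
  have hparts : ∀ p : ℝ × ℝ, ∫ s in p.1..p.2, Complex.exp (Complex.I * t * s) • f s =
      ((Complex.I * t)⁻¹ * Complex.exp (Complex.I * t * p.2)) • f p.2
      - ((Complex.I * t)⁻¹ * Complex.exp (Complex.I * t * p.1)) • f p.1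
      - (Complex.I * t)⁻¹ • ∫ s in p.1..p.2, Complex.exp (Complex.I * t * s) • deriv f s := by
    intro p
    have := intervalIntegral.integral_smul_deriv_eq_deriv_smul (a := p.1) (b := p.2)
      (fun x _ => hexp x) (fun x _ => hd x) (hcont.intervalIntegrable _ _)
      (hf'.intervalIntegrable)
    rw [← intervalIntegral.integral_smul]
    simp only [smul_smul]
    rw [this]
    abel
  have hbdry : Tendsto (fun s : ℝ => ((Complex.I * t)⁻¹ * Complex.exp (Complex.I * t * s)) • f s)
      (cocompact ℝ) (𝓝 0) := by
    rw [tendsto_zero_iff_norm_tendsto_zero]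
    simpa [norm_smul, hnorm] using h0.norm.const_mul ‖(Complex.I * t)⁻¹‖
  have hint : Integrable fun s : ℝ => Complex.exp (Complex.I * t * s) • deriv f s :=
    hf'.bdd_smul 1 hcont.aestronglyMeasurable
      (Eventually.of_forall fun s => (hnorm s).le)
  simp only [hparts]
  have h1 := (hbdry.mono_left atTop_le_cocompact).comp
    (tendsto_snd (f := (atBot : Filter ℝ)) (g := (atTop : Filter ℝ)))
  have h2 := (hbdry.mono_left atBot_le_cocompact).comp
    (tendsto_fst (f := (atBot : Filter ℝ)) (g := (atTop : Filter ℝ)))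
  have h3 := (intervalIntegral_tendsto_integral hint
    (tendsto_fst (f := (atBot : Filter ℝ)) (g := (atTop : Filter ℝ)))
    (tendsto_snd (f := (atBot : Filter ℝ)) (g := (atTop : Filter ℝ)))).const_smul
      (Complex.I * t)⁻¹
  simpa using (h1.sub h2).sub h3

/-- If `f` vanishes at infinity and `g` is an integrable function with
`𝓕 (deriv f) x = 2 π i x g x` almost everywhere, then `f` is the inverse Fourier transform
of `g`. -/
lemma fourierInv_eq_of_fourier_deriv_eq [CompleteSpace E] {f g : ℝ → E} (hf : ContDiff ℝ 1 f)
    (hf' : Integrable (deriv f)) (hFf' : Integrable (𝓕 (deriv f)))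
    (h0 : Tendsto f (cocompact ℝ) (𝓝 0)) (hg : Integrable g)
    (hfg : ∀ᵐ x : ℝ, 𝓕 (deriv f) x = (2 * Real.pi * Complex.I * x : ℂ) • g x) (s : ℝ) :
    𝓕⁻ g s = f s := by
  have hxg : Integrable fun x : ℝ => x • g x := by
    refine (hFf'.smul (2 * Real.pi * Complex.I : ℂ)⁻¹).congr ?_
    filter_upwards [hfg] with x hx
    have h2pi : (2 * Real.pi * Complex.I : ℂ) ≠ 0 := Complex.two_pi_I_ne_zero
    rw [Pi.smul_apply, hx, smul_smul, ← mul_assoc, inv_mul_cancel₀ h2pi, one_mul,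
      Complex.coe_smul]
  have hderiv : ∀ s : ℝ, HasDerivAt (fun s => 𝓕⁻ g s - f s) 0 s := by
    intro s
    have h1 := (Real.hasDerivAt_fourier hg hxg (-s)).scomp s (hasDerivAt_neg s)
    have h2 : (-1 : ℝ) • 𝓕 (fun x : ℝ => (-2 * Real.pi * Complex.I * x : ℂ) • g x) (-s)
        = deriv f s := by
      rw [← congrFun ((hf.continuous_deriv le_rfl).fourierInv_fourier_eq hf' hFf') s,
        Real.fourierInv_eq_fourier_neg, Real.fourier_real_eq, Real.fourier_real_eq,
        ← MeasureTheory.integral_smul]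
      refine integral_congr_ae ?_
      filter_upwards [hfg] with x hx
      rw [hx, smul_comm, neg_one_smul, ← neg_smul]
      congr 2
      ring
    rw [h2] at h1
    have h3 := h1.sub (hf.differentiable one_ne_zero s).hasDerivAt
    rw [sub_self] at h3
    refine h3.congr_of_eventuallyEq (Eventually.of_forall fun x => ?_)
    simp [Real.fourierInv_eq_fourier_neg]
  have hconst : ∀ x, 𝓕⁻ g x - f x = 𝓕⁻ g s - f s := fun x =>
    is_const_of_deriv_eq_zero (fun y => (hderiv y).differentiableAt)
      (fun y => (hderiv y).deriv) x s
  have hlim : Tendsto (fun x => 𝓕⁻ g x - f x) atTop (𝓝 0) := by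
    have h1 : Tendsto (fun x => 𝓕⁻ g x) atTop (𝓝 0) := by
      simp only [Real.fourierInv_eq_fourier_neg]
      exact ((Real.zero_at_infty_fourier g).mono_left atBot_le_cocompact).comp
        tendsto_neg_atTop_atBot
    simpa using h1.sub (h0.mono_left atTop_le_cocompact)
  simp only [hconst] at hlim
  exact sub_eq_zero.mp (tendsto_nhds_unique tendsto_const_nhds hlim)

end FourierAux

/-- Let `H ∈ C^∞(ℝ, L(X))` with
`‖H^{(k)}(s)‖ ≤ η_k |s|^{-(k+1)δ}` for `|s| ≥ b` (`b > 0`, `δ ∈ (1/2, 1)`,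
`η_k > 0`) and `H'(s) = -i H(s)²` for `|s| ≥ b`.  Let `G ∈ L¹(ℝ, L(X))` be given
for `t ≠ 0` by the improper Riemann integral `G(t) = (1/2π) ∫_ℝ H(s) e^{its} ds`.
Then `Ĝ(λ) = ∫_ℝ G(t) e^{-iλt} dt = H(λ)` for every `λ ∈ ℝ`. -/
theorem stmt10 {X : Type*} [NormedAddCommGroup X] [NormedSpace ℂ X] [CompleteSpace X]
    (H : ℝ → X →L[ℂ] X) (hH : ContDiff ℝ (⊤ : ℕ∞) H)
    (b δ : ℝ) (η : ℕ → ℝ) (hb : 0 < b) (hδ : 1 / 2 < δ ∧ δ < 1)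
    (hη : ∀ k : ℕ, 0 < η k)
    (hbound : ∀ (k : ℕ) (s : ℝ), b ≤ |s| →
      ‖iteratedDeriv k H s‖ ≤ η k * |s| ^ (-(((k : ℝ) + 1) * δ)))
    (hH' : ∀ s : ℝ, b ≤ |s| → deriv H s = (-Complex.I) • (H s * H s))
    (G : ℝ → X →L[ℂ] X)
    (hGint : Integrable G (volume : Measure ℝ))
    (hG : ∀ t : ℝ, t ≠ 0 →
      Tendsto
        (fun p : ℝ × ℝ =>
          (1 / (2 * Real.pi)) • ∫ s in p.1..p.2, Complex.exp (Complex.I * t * s) • H s)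
        (atBot ×ˢ atTop) (nhds (G t))) :
    ∀ l : ℝ, (∫ t : ℝ, Complex.exp (-(Complex.I * l * t)) • G t) = H l := by
  have hcd : ∀ k : ℕ, ContDiff ℝ 1 (iteratedDeriv k H) := fun k => by
    rw [iteratedDeriv_eq_iterate]
    exact ContDiff.iterate_deriv' 1 k (hH.of_le (by exact_mod_cast le_top))
  have hint : ∀ k : ℕ, 1 ≤ k → Integrable (iteratedDeriv k H) := by
    intro k hk
    have hk' : (1 : ℝ) ≤ k := by exact_mod_cast hk
    refine (hcd k).continuous.integrable_of_norm_le_rpow_abs hb (p := ((k : ℝ) + 1) * δ) ?_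
      (hη k).le (hbound k)
    nlinarith [hδ.1]
  have h0 : Tendsto H (cocompact ℝ) (nhds 0) := by
    have hlim : Tendsto (fun s : ℝ => η 0 * |s| ^ (-δ)) (cocompact ℝ) (nhds 0) := by
      simpa using ((tendsto_rpow_neg_atTop (by linarith [hδ.1] : 0 < δ)).comp
        (tendsto_norm_cocompact_atTop (E := ℝ))).const_mul (η 0)
    refine squeeze_zero_norm' ?_ hlim
    filter_upwards [(tendsto_norm_cocompact_atTop (E := ℝ)).eventually_ge_atTop b] with s hs
    simpa using hbound 0 s hs
  have hi1 : Integrable (deriv H) := by simpa [iteratedDeriv_one] using hint 1 le_rfl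
  have hi2 : Integrable (deriv (deriv H)) := by
    simpa [iteratedDeriv_succ, iteratedDeriv_zero] using hint 2 (by norm_num)
  have hi3 : Integrable (deriv (deriv (deriv H))) := by
    simpa [iteratedDeriv_succ, iteratedDeriv_zero] using hint 3 (by norm_num)
  have hd1 : Differentiable ℝ (deriv H) := by
    simpa [iteratedDeriv_one] using (hcd 1).differentiable one_ne_zero
  have hd2 : Differentiable ℝ (deriv (deriv H)) := by
    simpa [iteratedDeriv_succ, iteratedDeriv_zero] using (hcd 2).differentiable one_ne_zero
  have hH1 : ContDiff ℝ 1 H := by simpa using hcd 0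
  have hF := hi1.fourier_of_deriv_deriv hd1 hi2 hd2 hi3
  have hpi : (Real.pi : ℂ) ≠ 0 := by exact_mod_cast Real.pi_ne_zero
  have h2pi : (-(2 * Real.pi) : ℝ) ≠ 0 := neg_ne_zero.mpr Real.two_pi_pos.ne'
  let g : ℝ → X →L[ℂ] X := fun x => (2 * Real.pi) • G (-(2 * Real.pi) * x)
  have hg : Integrable g := (hGint.comp_mul_left' h2pi).smul (2 * Real.pi)
  have hfg : ∀ᵐ x : ℝ, FourierTransform.fourier (deriv H) x
      = (2 * Real.pi * Complex.I * x : ℂ) • g x := by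
    filter_upwards [Measure.ae_ne volume (0 : ℝ)] with x hx
    have ht : -(2 * Real.pi) * x ≠ 0 := mul_ne_zero h2pi hx
    have hGt := tendsto_nhds_unique (hG _ ht)
      ((tendsto_intervalIntegral_exp_smul hH1 hi1 h0 ht).const_smul (1 / (2 * Real.pi)))
    have hxc : (x : ℂ) ≠ 0 := by exact_mod_cast hx
    simp only [g]
    rw [hGt, Real.fourier_real_eq_integral_exp_smul, smul_smul,
      mul_one_div_cancel Real.two_pi_pos.ne', one_smul, ← neg_smul, smul_smul]
    have hscal : (2 * Real.pi * Complex.I * x : ℂ) *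
        -(Complex.I * ((-(2 * Real.pi) * x : ℝ) : ℂ))⁻¹ = 1 := by
      push_cast
      field_simp
    rw [hscal, one_smul]
    congr 1 with s : 1
    congr 2
    push_cast
    ring
  intro l
  rw [← fourierInv_eq_of_fourier_deriv_eq hH1 hi1 hF h0 hg hfg l, Real.fourierInv_eq_fourier_neg,
    Real.fourier_real_eq_integral_exp_smul]
  have hcv := Measure.integral_comp_mul_left
    (fun t : ℝ => Complex.exp (-(Complex.I * l * t)) • G t) (-(2 * Real.pi))
  rw [inv_neg, abs_neg, abs_of_pos (by positivity)] at hcv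
  rw [← one_smul ℝ (∫ t : ℝ, Complex.exp (-(Complex.I * l * t)) • G t),
    ← mul_inv_cancel₀ Real.two_pi_pos.ne', ← smul_smul, ← hcv, ← MeasureTheory.integral_smul]
  congr 1 with x : 1
  simp only [g]
  rw [smul_comm]
  congr 3
  push_cast
  ring
end

section
/- Let X = ℂ and let φ : ℝ → ℂ be defined by φ := Σ_{n=2}^∞ n·χ_{[n, n+1/n]} (i.e. φ(t) = n if t ∈ [n, n+1/n] for some integer n ≥ 2 and φ(t) = 0 otherwise). Then: (i) φ has finite Stepanoff norm, namely sup_{t∈ℝ} ∫_t^{t+1} |φ(s)| ds ≤ 2; (ii) u_φ(t) := ∫_0^∞ e^{−s} φ(t−s) ds defines a bounded mild solution of u′ = −u + φ on ℝ; (iii) no mild solution of u′ = −u + φ on ℝ or on [0, ∞) is uniformly continuous. -/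
open MeasureTheory Filter Complex

/-- The function `Σ_{n≥2} n·χ_{[n, n+1/n]}`. -/
noncomputable def spikeTrain (t : ℝ) : ℂ :=
  if 2 ≤ ⌊t⌋₊ ∧ t ≤ ⌊t⌋₊ + 1 / (⌊t⌋₊ : ℝ) then (⌊t⌋₊ : ℂ) else 0

lemma natCast_add_one_div_lt {n : ℕ} (hn : 2 ≤ n) : (n : ℝ) + 1 / n < n + 1 := by
  have h : (1 : ℝ) < n := by exact_mod_cast hn
  have := (div_lt_one (by linarith)).2 h
  linarith

lemma spikeTrain_of_mem {n : ℕ} (hn : 2 ≤ n) {t : ℝ}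
    (ht : t ∈ Set.Icc (n : ℝ) (n + 1 / n)) : spikeTrain t = n := by
  have hf : ⌊t⌋₊ = n :=
    Nat.floor_eq_on_Ico n t ⟨ht.1, ht.2.trans_lt (natCast_add_one_div_lt hn)⟩
  rw [spikeTrain, hf, if_pos ⟨hn, ht.2⟩]

lemma spikeTrain_of_mem_Ioo {n : ℕ} {t : ℝ}
    (ht : t ∈ Set.Ioo ((n : ℝ) + 1 / n) (n + 1)) : spikeTrain t = 0 := by
  have h0 : (0 : ℝ) ≤ 1 / n := by positivity
  have hf : ⌊t⌋₊ = n := Nat.floor_eq_on_Ico n t ⟨by linarith [ht.1], ht.2⟩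
  rw [spikeTrain, hf, if_neg fun h => absurd h.2 (not_le.2 ht.1)]

lemma spikeTrain_of_lt_two {t : ℝ} (ht : t < 2) : spikeTrain t = 0 :=
  if_neg fun h => absurd ht (not_lt.2 (by exact_mod_cast (Nat.le_floor_iff' two_ne_zero).1 h.1))

lemma eq_spikeTrain {φ : ℝ → ℂ}
    (hφ_on : ∀ n : ℕ, 2 ≤ n → ∀ t ∈ Set.Icc (n : ℝ) (n + 1 / n), φ t = (n : ℂ))
    (hφ_off : ∀ t : ℝ, (∀ n : ℕ, 2 ≤ n → t ∉ Set.Icc (n : ℝ) (n + 1 / n)) → φ t = 0) :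
    φ = spikeTrain := by
  funext t
  by_cases h : ∃ n : ℕ, 2 ≤ n ∧ t ∈ Set.Icc (n : ℝ) (n + 1 / n)
  · obtain ⟨n, hn, ht⟩ := h
    rw [hφ_on n hn t ht, spikeTrain_of_mem hn ht]
  · push Not at h
    rw [hφ_off t h, spikeTrain, if_neg]
    exact fun h' => h _ h'.1 ⟨(Nat.le_floor_iff' (by omega)).1 le_rfl, h'.2⟩

lemma measurable_spikeTrain : Measurable spikeTrain := by
  have hf : Measurable fun t : ℝ => ⌊t⌋₊ := Nat.measurable_floor
  have hr : Measurable fun t : ℝ => (⌊t⌋₊ : ℝ) := measurable_from_nat.comp hf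
  have hc : Measurable fun t : ℝ => (⌊t⌋₊ : ℂ) := measurable_from_nat.comp hf
  refine Measurable.ite ?_ hc measurable_const
  exact (hf measurableSet_Ici).inter
    (measurableSet_le measurable_id (hr.add (measurable_const.div hr)))

lemma norm_spikeTrain_le (t : ℝ) : ‖spikeTrain t‖ ≤ |t| := by
  unfold spikeTrain
  split_ifs with h
  · rw [Complex.norm_natCast]
    exact ((Nat.le_floor_iff' (by omega)).1 le_rfl).trans (le_abs_self t)
  · simp

lemma intervalIntegrable_spikeTrain (a b : ℝ) : IntervalIntegrable spikeTrain volume a b :=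
  (continuous_abs.intervalIntegrable a b).mono_fun
    measurable_spikeTrain.aestronglyMeasurable
    (Eventually.of_forall fun t => by simpa using norm_spikeTrain_le t)

lemma countable_not_continuousAt_spikeTrain : {t | ¬ ContinuousAt spikeTrain t}.Countable := by
  refine ((Set.countable_range fun n : ℤ => (n : ℝ)).union
    (Set.countable_range fun n : ℕ => (n : ℝ) + 1 / n)).mono fun t ht => ?_
  by_contra hS
  simp only [Set.mem_union, Set.mem_range, not_or, not_exists] at hS
  refine ht ?_
  have hlt : (⌊t⌋ : ℝ) < t := lt_of_le_of_ne (Int.floor_le t) (hS.1 _)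
  have hfl : ∀ᶠ s in nhds t, ⌊s⌋₊ = ⌊t⌋₊ := by
    filter_upwards [Ioo_mem_nhds hlt (Int.lt_floor_add_one t)] with s hs
    rw [← Int.floor_toNat, ← Int.floor_toNat, Int.floor_eq_iff.2 ⟨hs.1.le, hs.2⟩]
  have hle : ∀ᶠ s in nhds t, (s ≤ ⌊t⌋₊ + 1 / (⌊t⌋₊ : ℝ) ↔ t ≤ ⌊t⌋₊ + 1 / (⌊t⌋₊ : ℝ)) := by
    rcases lt_or_gt_of_ne (hS.2 ⌊t⌋₊) with h | h
    · filter_upwards [lt_mem_nhds h] with s hs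
      simp only [not_le.2 hs, not_le.2 h]
    · filter_upwards [gt_mem_nhds h] with s hs
      simp only [hs.le, h.le]
  refine (continuousAt_const (y := spikeTrain t)).congr ?_
  filter_upwards [hfl, hle] with s h1 h2
  rw [spikeTrain, spikeTrain, h1]
  simp only [h2]

lemma integral_norm_spikeTrain_natCast {n : ℕ} (hn : 2 ≤ n) :
    ∫ s in (n : ℝ)..(n + 1), ‖spikeTrain s‖ = 1 := by
  have hn0 : (n : ℝ) ≠ 0 := by positivity
  have h0 : (0 : ℝ) ≤ 1 / n := by positivity
  have h1 : ∫ s in (n : ℝ)..(n + 1 / n), ‖spikeTrain s‖ = 1 := by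
    rw [intervalIntegral.integral_congr_Ioo_of_le (g := fun _ => (n : ℝ)) (by linarith)]
    · simp [hn0]
    · intro s hs
      simp [spikeTrain_of_mem hn (Set.Ioo_subset_Icc_self hs)]
  have h2 : ∫ s in ((n : ℝ) + 1 / n)..(n + 1), ‖spikeTrain s‖ = 0 := by
    rw [intervalIntegral.integral_congr_Ioo_of_le (g := fun _ => (0 : ℝ))
      (natCast_add_one_div_lt hn).le]
    · simp
    · intro s hs
      simp [spikeTrain_of_mem_Ioo hs]
  rw [← intervalIntegral.integral_add_adjacent_intervals
    (intervalIntegrable_spikeTrain _ _).norm (intervalIntegrable_spikeTrain _ _).norm, h1, h2,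
    add_zero]

lemma integral_spikeTrain_spike {n : ℕ} (hn : 2 ≤ n) :
    ∫ s in (n : ℝ)..(n + 1 / n), spikeTrain s = 1 := by
  have hn0 : (n : ℂ) ≠ 0 := by simp; omega
  have h0 : (0 : ℝ) ≤ 1 / n := by positivity
  rw [intervalIntegral.integral_congr_Ioo_of_le (g := fun _ => (n : ℂ)) (by linarith)]
  · simp [hn0]
  · intro s hs
    simp [spikeTrain_of_mem hn (Set.Ioo_subset_Icc_self hs)]

lemma integral_norm_spikeTrain_intCast_le (m : ℤ) :
    ∫ s in (m : ℝ)..(m + 1), ‖spikeTrain s‖ ≤ 1 := by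
  rcases lt_or_ge m 2 with hm | hm
  · rw [intervalIntegral.integral_congr_Ioo_of_le (g := fun _ => (0 : ℝ)) (by linarith)]
    · simp
    · intro s hs
      have : (m : ℝ) + 1 ≤ 2 := by exact_mod_cast hm
      simp [spikeTrain_of_lt_two (hs.2.trans_le this)]
  · lift m to ℕ using by omega
    exact_mod_cast (integral_norm_spikeTrain_natCast (by omega : 2 ≤ m)).le

lemma integral_norm_spikeTrain_le (t : ℝ) : ∫ s in t..(t + 1), ‖spikeTrain s‖ ≤ 2 := by
  have hi : ∀ a b, IntervalIntegrable (fun s => ‖spikeTrain s‖) volume a b :=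
    fun a b => (intervalIntegrable_spikeTrain a b).norm
  calc ∫ s in t..(t + 1), ‖spikeTrain s‖
      ≤ ∫ s in (⌊t⌋ : ℝ)..(⌊t⌋ + 1 + 1), ‖spikeTrain s‖ :=
        intervalIntegral.integral_mono_interval (Int.floor_le t) (by linarith)
          (by linarith [Int.lt_floor_add_one t])
          (Eventually.of_forall fun s => norm_nonneg _) (hi _ _)
    _ = (∫ s in (⌊t⌋ : ℝ)..(⌊t⌋ + 1), ‖spikeTrain s‖)
          + ∫ s in ((⌊t⌋ : ℝ) + 1)..(⌊t⌋ + 1 + 1), ‖spikeTrain s‖ :=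
        (intervalIntegral.integral_add_adjacent_intervals (hi _ _) (hi _ _)).symm
    _ ≤ 1 + 1 := by
        gcongr
        · exact integral_norm_spikeTrain_intCast_le _
        · exact_mod_cast integral_norm_spikeTrain_intCast_le (⌊t⌋ + 1)
    _ = 2 := by norm_num

section Duhamel

variable {φ : ℝ → ℂ}

lemma intervalIntegrable_exp_smul (hφ : ∀ a b, IntervalIntegrable φ volume a b) (a b : ℝ) :
    IntervalIntegrable (fun r => Real.exp r • φ r) volume a b :=
  (hφ a b).continuousOn_smul Real.continuous_exp.continuousOn

/-- For a forcing term supported in `(0, ∞)`, the convolution with `e^{-s}` is the Duhamel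
integral started at `0`. -/
lemma integral_Ioi_exp_neg_smul_eq (hφ : ∀ a b, IntervalIntegrable φ volume a b)
    (h0 : ∀ t ≤ 0, φ t = 0) (t : ℝ) :
    ∫ s in Set.Ioi (0 : ℝ), Real.exp (-s) • φ (t - s)
      = Real.exp (-t) • ∫ r in (0 : ℝ)..t, Real.exp r • φ r := by
  set f : ℝ → ℂ := fun r => Real.exp r • φ r with hf
  have hfi : ∀ a b, IntervalIntegrable f volume a b := intervalIntegrable_exp_smul hφ
  have hz : Set.EqOn f 0 (Set.Iic 0) := fun r hr => by simp [hf, h0 r hr]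
  have hI0 : IntegrableOn f (Set.Iic 0) :=
    (integrableOn_zero (ε' := ℂ)).congr_fun hz.symm measurableSet_Iic
  have hIt : IntegrableOn f (Set.Iic t) := by
    refine (hI0.union (hfi 0 t).1).mono_set fun x hx => ?_
    rcases le_or_gt x 0 with h | h
    · exact Or.inl h
    · exact Or.inr ⟨h, hx⟩
  have hflip : ∫ s in Set.Ioi (0 : ℝ), f (t - s) = ∫ r in Set.Iic t, f r := by
    rw [integral_Iic_eq_integral_Iio, ← integral_indicator measurableSet_Ioi,
      ← integral_indicator measurableSet_Iio,
      ← integral_sub_left_eq_self (Set.indicator (Set.Iio t) f) volume t]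
    congr 1
    funext s
    simp [Set.indicator_apply]
  rw [← intervalIntegral.integral_Iic_sub_Iic hI0 hIt,
    setIntegral_congr_fun measurableSet_Iic hz, ← hflip]
  simp only [Pi.zero_apply, integral_zero, sub_zero]
  rw [← MeasureTheory.integral_smul]
  simp only [hf, smul_smul, ← Real.exp_add]
  simp only [← add_sub_assoc, neg_add_cancel, zero_sub]

lemma continuous_duhamel (hφ : ∀ a b, IntervalIntegrable φ volume a b) :
    Continuous fun t => Real.exp (-t) • ∫ r in (0 : ℝ)..t, Real.exp r • φ r :=
  (Real.continuous_exp.comp continuous_neg).smul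
    (intervalIntegral.continuous_primitive (intervalIntegrable_exp_smul hφ) 0)

lemma duhamel_mild (hφ : ∀ a b, IntervalIntegrable φ volume a b) (hm : StronglyMeasurable φ)
    (hc : {t | ¬ ContinuousAt φ t}.Countable) (t : ℝ) :
    (Real.exp (-t) • ∫ r in (0 : ℝ)..t, Real.exp r • φ r)
      = -(∫ τ in (0 : ℝ)..t, Real.exp (-τ) • ∫ r in (0 : ℝ)..τ, Real.exp r • φ r)
        + ∫ s in (0 : ℝ)..t, φ s := by
  have hu := continuous_duhamel hφ
  set u : ℝ → ℂ := fun t => Real.exp (-t) • ∫ r in (0 : ℝ)..t, Real.exp r • φ r with hu_def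
  have key := integral_eq_of_hasDerivAt_off_countable u (fun x => -u x + φ x) (a := 0) (b := t)
    hc hu.continuousOn (fun x hx => ?_) ((hu.neg.intervalIntegrable 0 t).add (hφ 0 t))
  · rw [intervalIntegral.integral_add (f := fun x => -u x) (hu.neg.intervalIntegrable 0 t)
        (hφ 0 t),
      intervalIntegral.integral_neg] at key
    have hu0 : u 0 = 0 := by simp [hu_def]
    rw [hu0, sub_zero] at key
    exact key.symm
  · have hx : ContinuousAt φ x := not_not.1 hx.2
    have h1 : HasDerivAt (fun t : ℝ => Real.exp (-t)) (-Real.exp (-x)) x := by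
      simpa using (hasDerivAt_neg x).exp
    have h2 : HasDerivAt (fun t : ℝ => ∫ r in (0 : ℝ)..t, Real.exp r • φ r)
        (Real.exp x • φ x) x :=
      intervalIntegral.integral_hasDerivAt_right (intervalIntegrable_exp_smul hφ 0 x)
        (Real.continuous_exp.stronglyMeasurable.smul hm).stronglyMeasurableAtFilter
        (Real.continuous_exp.continuousAt.smul hx)
    refine (h1.smul h2).congr_deriv ?_
    rw [smul_smul, ← Real.exp_add, neg_add_cancel, Real.exp_zero, one_smul, neg_smul, add_comm]

/-- The Duhamel integral of a forcing term with Stepanoff norm at most `2` is bounded. -/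
lemma norm_duhamel_le (hφ : ∀ a b, IntervalIntegrable φ volume a b) (h0 : ∀ t ≤ 0, φ t = 0)
    (hS : ∀ t, ∫ s in t..(t + 1), ‖φ s‖ ≤ 2) (t : ℝ) :
    ‖Real.exp (-t) • ∫ r in (0 : ℝ)..t, Real.exp r • φ r‖ ≤ 4 := by
  have hfi := intervalIntegrable_exp_smul hφ
  have step : ∀ n : ℕ, ∀ t : ℝ, t ≤ n →
      ‖∫ r in (0 : ℝ)..t, Real.exp r • φ r‖ ≤ 4 * Real.exp t := by
    intro n
    induction n with
    | zero =>
      intro t ht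
      rw [intervalIntegral.integral_congr (g := fun _ => (0 : ℂ))]
      · simp; positivity
      · intro r hr
        rw [Set.uIcc_of_ge (by simpa using ht)] at hr
        simp [h0 r hr.2]
    | succ n ih =>
      intro t ht
      have h1 := ih (t - 1) (by push_cast at ht; linarith)
      have h2 : ‖∫ r in (t - 1)..t, Real.exp r • φ r‖ ≤ Real.exp t * 2 := by
        calc ‖∫ r in (t - 1)..t, Real.exp r • φ r‖
            ≤ ∫ r in (t - 1)..t, Real.exp t * ‖φ r‖ := by
              refine intervalIntegral.norm_integral_le_of_norm_le (by linarith)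
                (Eventually.of_forall fun r hr => ?_) ((hφ _ _).norm.const_mul _)
              rw [norm_smul, Real.norm_eq_abs, Real.abs_exp]
              gcongr
              exact hr.2
          _ = Real.exp t * ∫ r in (t - 1)..t, ‖φ r‖ := intervalIntegral.integral_const_mul _ _
          _ ≤ Real.exp t * 2 := by
              gcongr
              simpa using hS (t - 1)
      rw [← intervalIntegral.integral_add_adjacent_intervals (hfi 0 (t - 1)) (hfi (t - 1) t)]
      have h3 : 2 * Real.exp (t - 1) ≤ Real.exp t := by
        have h4 : Real.exp t = Real.exp 1 * Real.exp (t - 1) := by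
          rw [← Real.exp_add]; congr 1; ring
        rw [h4]
        gcongr
        linarith [Real.add_one_le_exp 1]
      linarith [norm_add_le (∫ r in (0 : ℝ)..(t - 1), Real.exp r • φ r)
        (∫ r in (t - 1)..t, Real.exp r • φ r)]
  rw [norm_smul, Real.norm_eq_abs, Real.abs_exp]
  calc Real.exp (-t) * ‖∫ r in (0 : ℝ)..t, Real.exp r • φ r‖
      ≤ Real.exp (-t) * (4 * Real.exp t) := by
        gcongr
        exact step ⌈t⌉₊ t (Nat.le_ceil t)
    _ = 4 := by rw [mul_left_comm, ← Real.exp_add]; simp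

end Duhamel

/-- The variation-of-constants integral equation on `[0, ∞)` has no uniformly continuous solution
when the forcing term is `spikeTrain`. -/
lemma not_uniformContinuousOn_of_mild {v : ℝ → ℂ} (hv : ContinuousOn v (Set.Ici 0))
    (hmild : ∀ t : ℝ, 0 ≤ t →
      v t = v 0 - (∫ s in (0 : ℝ)..t, v s) + ∫ s in (0 : ℝ)..t, spikeTrain s) :
    ¬ UniformContinuousOn v (Set.Ici 0) := by
  intro huc
  have hvi : ∀ a b, 0 ≤ a → 0 ≤ b → IntervalIntegrable v volume a b := fun a b ha hb =>
    (hv.mono fun x hx => (le_min ha hb).trans hx.1).intervalIntegrable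
  have hincr : ∀ a b, 0 ≤ a → 0 ≤ b →
      v b - v a = -(∫ s in a..b, v s) + ∫ s in a..b, spikeTrain s := by
    intro a b ha hb
    rw [hmild a ha, hmild b hb,
      ← intervalIntegral.integral_interval_sub_left (hvi 0 b le_rfl hb) (hvi 0 a le_rfl ha),
      ← intervalIntegral.integral_interval_sub_left (intervalIntegrable_spikeTrain 0 b)
        (intervalIntegrable_spikeTrain 0 a)]
    ring
  obtain ⟨δ₀, hδ₀, hδ₀v⟩ := Metric.uniformContinuousOn_iff.1 huc (1 / 4) (by norm_num)
  obtain ⟨δ, hδ, hδ1, hδδ₀⟩ : ∃ δ : ℝ, 0 < δ ∧ δ ≤ 1 ∧ δ < δ₀ :=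
    ⟨min 1 (δ₀ / 2), by positivity, min_le_left _ _, (min_le_right _ _).trans_lt (by linarith)⟩
  have hosc : ∀ a s, 0 ≤ a → a ≤ s → s ≤ a + δ → ‖v s - v a‖ ≤ 1 / 4 := by
    intro a s ha h1 h2
    rw [← dist_eq_norm]
    refine (hδ₀v s (ha.trans h1) a ha ?_).le
    rw [Real.dist_eq, abs_of_nonneg (by linarith)]
    linarith
  have hbound : ∀ a, 0 ≤ a → ‖v a‖ * δ ≤ 3 := by
    intro a ha
    have hφ : ‖∫ s in a..(a + δ), spikeTrain s‖ ≤ 2 :=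
      calc ‖∫ s in a..(a + δ), spikeTrain s‖
          ≤ ∫ s in a..(a + δ), ‖spikeTrain s‖ :=
            intervalIntegral.norm_integral_le_integral_norm (by linarith)
        _ ≤ ∫ s in a..(a + 1), ‖spikeTrain s‖ :=
            intervalIntegral.integral_mono_interval le_rfl (by linarith) (by linarith)
              (Eventually.of_forall fun s => norm_nonneg _)
              (intervalIntegrable_spikeTrain _ _).norm
        _ ≤ 2 := integral_norm_spikeTrain_le a
    have hd : ‖∫ s in a..(a + δ), (v s - v a)‖ ≤ 1 / 4 * |a + δ - a| := by
      refine intervalIntegral.norm_integral_le_of_norm_le_const fun s hs => ?_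
      rw [Set.uIoc_of_le (by linarith)] at hs
      exact hosc a s ha hs.1.le hs.2
    rw [add_sub_cancel_left, abs_of_pos hδ] at hd
    have hsplit : ((δ : ℝ) : ℂ) * v a = (∫ s in a..(a + δ), spikeTrain s)
        - (v (a + δ) - v a) - ∫ s in a..(a + δ), (v s - v a) := by
      rw [hincr a (a + δ) ha (by linarith), intervalIntegral.integral_sub
        (hvi _ _ ha (by linarith)) intervalIntegrable_const, intervalIntegral.integral_const]
      simp
    have hnorm : ‖((δ : ℝ) : ℂ) * v a‖ = ‖v a‖ * δ := by
      rw [norm_mul, Complex.norm_real, Real.norm_eq_abs, abs_of_pos hδ, mul_comm]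
    rw [← hnorm, hsplit]
    have hinc := hosc a (a + δ) ha (by linarith) le_rfl
    refine (norm_sub_le _ _).trans ?_
    linarith [norm_sub_le (∫ s in a..(a + δ), spikeTrain s) (v (a + δ) - v a)]
  obtain ⟨n, hn⟩ := exists_nat_gt (max 2 (max (1 / δ) (2 * (3 / δ))))
  simp only [max_lt_iff] at hn
  obtain ⟨hn2, hnδ, hnM⟩ := hn
  have hn2' : 2 ≤ n := by exact_mod_cast hn2.le
  have hn0 : (0 : ℝ) < n := by linarith
  have hinv : 1 / (n : ℝ) < δ := by rwa [one_div_lt hn0 hδ]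
  have hinv0 : 0 < 1 / (n : ℝ) := by positivity
  have h1 := hosc n (n + 1 / n) hn0.le (by linarith) (by linarith)
  have h2 : ‖∫ s in (n : ℝ)..(n + 1 / n), v s‖ ≤ 3 / δ * |(n : ℝ) + 1 / n - n| := by
    refine intervalIntegral.norm_integral_le_of_norm_le_const fun s hs => ?_
    rw [Set.uIoc_of_le (by linarith)] at hs
    rw [le_div_iff₀ hδ]
    exact hbound s (hn0.le.trans hs.1.le)
  rw [add_sub_cancel_left, abs_of_pos hinv0] at h2
  have h3 : 3 / δ * (1 / n) < 1 / 2 := by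
    rw [mul_one_div, div_lt_iff₀ hn0]
    linarith
  have h4 := hincr n (n + 1 / n) hn0.le (by linarith)
  rw [integral_spikeTrain_spike hn2'] at h4
  have h5 : (1 : ℂ) = (v (n + 1 / n) - v n) + ∫ s in (n : ℝ)..(n + 1 / n), v s := by
    rw [h4]; ring
  have h6 := norm_add_le (v (n + 1 / n) - v n) (∫ s in (n : ℝ)..(n + 1 / n), v s)
  rw [← h5, norm_one] at h6
  linarith

/-- Let `φ : ℝ → ℂ` be `φ = Σ_{n≥2} n·χ_{[n, n+1/n]}`.  Then
(i) `φ` has Stepanoff norm `sup_t ∫_t^{t+1} |φ| ≤ 2`;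
(ii) `u_φ(t) = ∫_0^∞ e^{-s} φ(t-s) ds` is a bounded mild solution of
`u' = -u + φ` on `ℝ`;
(iii) no mild solution of `u' = -u + φ` on `ℝ` or on `[0, ∞)` is uniformly
continuous. -/
theorem stmt16 (φ : ℝ → ℂ)
    (hφ_on : ∀ n : ℕ, 2 ≤ n → ∀ t ∈ Set.Icc (n : ℝ) (n + 1 / n), φ t = (n : ℂ))
    (hφ_off : ∀ t : ℝ, (∀ n : ℕ, 2 ≤ n → t ∉ Set.Icc (n : ℝ) (n + 1 / n)) → φ t = 0) :
    -- (i) finite Stepanoff norm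
    (∀ t : ℝ, (∫ s in t..(t + 1), ‖φ s‖) ≤ 2) ∧
    -- (ii) `u_φ` is a bounded mild solution on `ℝ`
    ((∃ Cb : ℝ, ∀ t : ℝ,
        ‖∫ s in Set.Ioi (0 : ℝ), Real.exp (-s) • φ (t - s)‖ ≤ Cb) ∧
      Continuous (fun t : ℝ => ∫ s in Set.Ioi (0 : ℝ), Real.exp (-s) • φ (t - s)) ∧
      (∀ t : ℝ, (∫ s in Set.Ioi (0 : ℝ), Real.exp (-s) • φ (t - s))
        = (∫ s in Set.Ioi (0 : ℝ), Real.exp (-s) • φ (0 - s))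
          - (∫ τ in (0 : ℝ)..t, ∫ s in Set.Ioi (0 : ℝ), Real.exp (-s) • φ (τ - s))
          + ∫ s in (0 : ℝ)..t, φ s)) ∧
    -- (iii) no mild solution on `ℝ` is uniformly continuous ...
    (∀ v : ℝ → ℂ,
      (Continuous v ∧ ∀ t : ℝ,
        v t = v 0 - (∫ s in (0 : ℝ)..t, v s) + ∫ s in (0 : ℝ)..t, φ s) →
      ¬ UniformContinuous v) ∧
    -- ... and no mild solution on `[0, ∞)` is uniformly continuous on `[0, ∞)`
    (∀ v : ℝ → ℂ,
      (ContinuousOn v (Set.Ici 0) ∧ ∀ t : ℝ, 0 ≤ t →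
        v t = v 0 - (∫ s in (0 : ℝ)..t, v s) + ∫ s in (0 : ℝ)..t, φ s) →
      ¬ UniformContinuousOn v (Set.Ici 0)) := by
  obtain rfl := eq_spikeTrain hφ_on hφ_off
  have h0 : ∀ t ≤ (0 : ℝ), spikeTrain t = 0 := fun t ht => spikeTrain_of_lt_two (by linarith)
  simp only [integral_Ioi_exp_neg_smul_eq intervalIntegrable_spikeTrain h0]
  refine ⟨integral_norm_spikeTrain_le, ⟨⟨4, norm_duhamel_le intervalIntegrable_spikeTrain h0
    integral_norm_spikeTrain_le⟩, continuous_duhamel intervalIntegrable_spikeTrain, fun t => ?_⟩,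
    fun v hv huc => ?_, fun v hv => not_uniformContinuousOn_of_mild hv.1 hv.2⟩
  · rw [intervalIntegral.integral_same, smul_zero, zero_sub]
    exact duhamel_mild intervalIntegrable_spikeTrain measurable_spikeTrain.stronglyMeasurable
      countable_not_continuousAt_spikeTrain t
  · exact not_uniformContinuousOn_of_mild hv.1.continuousOn (fun t _ => hv.2 t)
      huc.uniformContinuousOn
end

section
/- Let X be a complex Banach space, T a C₀-semigroup on X with generator A, J ∈ {ℝ, [0,∞)}, φ ∈ L¹_loc(J, X), and ω : J → X. Then the following three statements are equivalent: (i) ω is a mild solution of ω′ = Aω + φ on J; (ii) ω is continuous and for every h > 0 the function M_h ω, where (M_h ω)(t) := (1/h)∫_0^h ω(t+s) ds, is a classical solution of u′ = Au + M_h φ on J, i.e. M_h ω is continuously differentiable, takes values in D(A) and satisfies (M_h ω)′(t) = A((M_h ω)(t)) + (M_h φ)(t) for all t ∈ J; (iii) ω is continuous and for every t₀ ∈ J and every t ≥ t₀ in J, ω(t) = T(t − t₀)ω(t₀) + ∫_{t₀}^t T(t − s)φ(s) ds. -/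
open MeasureTheory Filter Complex

open Set Topology

section

variable {X : Type*} [NormedAddCommGroup X] [NormedSpace ℂ X]

/-- `y` is the value at `x` of the generator of the operator family `T`. -/
def IsGeneratorValue (T : ℝ → X →L[ℂ] X) (x y : X) : Prop :=
  Tendsto (fun h : ℝ => h⁻¹ • (T h x - x)) (𝓝[>] 0) (𝓝 y)

lemma IsGeneratorValue.sub {T : ℝ → X →L[ℂ] X} {x y x' y' : X}
    (h : IsGeneratorValue T x y) (h' : IsGeneratorValue T x' y') :
    IsGeneratorValue T (x - x') (y - y') := by
  refine (Tendsto.sub h h').congr fun r => ?_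
  rw [map_sub, ← smul_sub]
  congr 1
  abel

lemma IsGeneratorValue.zero (T : ℝ → X →L[ℂ] X) : IsGeneratorValue T 0 0 := by
  simp [IsGeneratorValue]

lemma IsGeneratorValue.smul {T : ℝ → X →L[ℂ] X} {x y : X}
    (h : IsGeneratorValue T x y) (c : ℝ) : IsGeneratorValue T (c • x) (c • y) := by
  refine (Tendsto.const_smul h c).congr fun r => ?_
  rw [ContinuousLinearMap.map_smul_of_tower, ← smul_sub, smul_comm]

lemma mean_tendsto [CompleteSpace X] {F : ℝ → ℝ → X} (hF : Continuous (Function.uncurry F)) :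
    Tendsto (fun h : ℝ => h⁻¹ • ∫ v in (0 : ℝ)..h, F h v) (𝓝[>] 0) (𝓝 (F 0 0)) := by
  have hc : Continuous fun h : ℝ => ∫ w in (0 : ℝ)..1, F h (h * w) :=
    intervalIntegral.continuous_parametric_intervalIntegral_of_continuous'
      (f := fun h w => F h (h * w))
      (hF.comp (continuous_fst.prodMk (continuous_fst.mul continuous_snd))) 0 1
  have h0 := (hc.tendsto 0).mono_left (nhdsWithin_le_nhds (s := Ioi 0))
  simp only [zero_mul, intervalIntegral.integral_const, sub_zero, one_smul] at h0
  refine h0.congr' ?_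
  filter_upwards [self_mem_nhdsWithin] with h hh
  rw [intervalIntegral.integral_comp_mul_left (F h) (ne_of_gt hh)]
  simp

lemma mean_comp_add_tendsto [CompleteSpace X] {f : ℝ → X} (hf : Continuous f) (t : ℝ) :
    Tendsto (fun h : ℝ => h⁻¹ • ∫ v in (0 : ℝ)..h, f (t + v)) (𝓝[>] 0) (𝓝 (f t)) := by
  simpa using mean_tendsto (F := fun _ v => f (t + v)) (by fun_prop)

section BoundedFamily

variable {S : ℝ → X →L[ℂ] X} {M : ℝ}

lemma continuous_uncurry_of_bounded (hS : ∀ x, Continuous fun u => S u x)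
    (hM : ∀ u, ‖S u‖ ≤ M) : Continuous fun p : ℝ × X => S p.1 p.2 := by
  have hM0 : 0 ≤ M := (norm_nonneg _).trans (hM 0)
  refine continuous_prod_of_continuous_lipschitzWith' _ M.toNNReal (fun u => ?_) hS
  refine (S u).lipschitz.weaken ?_
  rw [← NNReal.coe_le_coe, Real.coe_toNNReal _ hM0]
  exact hM u

lemma intervalIntegral_convolution_swap (hS : ∀ x, Continuous fun u => S u x)
    (hM : ∀ u, ‖S u‖ ≤ M) {k : ℝ → ℝ → ℝ} (hk : Continuous (Function.uncurry k))
    {ψ : ℝ → X} (hψ : Integrable ψ) {a b c d : ℝ} (hab : a ≤ b) (hcd : c ≤ d) :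
    ∫ s in a..b, ∫ v in c..d, S (k s v) (ψ (s + v)) =
      ∫ v in c..d, ∫ s in a..b, S (k s v) (ψ (s + v)) := by
  simp only [intervalIntegral.integral_of_le hab, intervalIntegral.integral_of_le hcd]
  refine integral_integral_swap ?_
  have h1 : Integrable (fun p : ℝ × ℝ => ψ (p.1 + p.2))
      ((volume.restrict (Ioc a b)).prod volume) :=
    ((measurePreserving_prod_add (volume.restrict (Ioc a b)) volume).integrable_comp
      (hψ.comp_snd _).aestronglyMeasurable).2 (hψ.comp_snd _)
  have h2 : Integrable (fun p : ℝ × ℝ => ψ (p.1 + p.2))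
      ((volume.restrict (Ioc a b)).prod (volume.restrict (Ioc c d))) :=
    h1.mono_measure (Measure.prod_mono le_rfl Measure.restrict_le_self)
  refine (h2.norm.const_mul M).mono' ?_ (ae_of_all _ fun p => ?_)
  · exact (continuous_uncurry_of_bounded hS hM).comp_aestronglyMeasurable
      (hk.aestronglyMeasurable.prodMk h2.aestronglyMeasurable)
  · exact (S _).le_of_opNorm_le (hM _) _

lemma continuous_convolution [CompleteSpace X] (hS : ∀ x, Continuous fun u => S u x)
    (hM : ∀ u, ‖S u‖ ≤ M) {ψ : ℝ → X} (hψ : Integrable ψ) {a b : ℝ} (hab : a ≤ b) :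
    Continuous fun v : ℝ => ∫ s in a..b, S (b - s) (ψ (s + v)) := by
  have hM0 : 0 ≤ M := (norm_nonneg _).trans (hM 0)
  have key : ∀ v : ℝ, ∫ s in a..b, S (b - s) (ψ (s + v)) =
      ∫ s, (Ioc a b).indicator (fun r => S (b - r) (ψ s)) (s - v) := by
    intro v
    rw [intervalIntegral.integral_of_le hab, ← integral_indicator measurableSet_Ioc,
      ← integral_sub_right_eq_self _ v]
    congr 1 with s
    simp [indicator]
  simp_rw [key]
  refine continuous_iff_continuousAt.2 fun v₀ => ?_
  refine continuousAt_of_dominated (bound := fun s => M * ‖ψ s‖) ?_ ?_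
    (hψ.norm.const_mul M) ?_
  · refine Eventually.of_forall fun v => ?_
    have hm : AEStronglyMeasurable (fun s => S (b - (s - v)) (ψ s)) volume :=
      (continuous_uncurry_of_bounded hS hM).comp_aestronglyMeasurable
        ((by fun_prop : Continuous fun s : ℝ => b - (s - v)).aestronglyMeasurable.prodMk
          hψ.aestronglyMeasurable)
    exact hm.indicator (measurableSet_Ioc.preimage (measurable_sub_const v))
  · refine Eventually.of_forall fun v => ae_of_all _ fun s => ?_
    exact (norm_indicator_le_norm_self _ _).trans ((S _).le_of_opNorm_le (hM _) _)
  · have hne : ∀ᵐ s : ℝ, s ∉ ({a + v₀, b + v₀} : Set ℝ) :=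
      measure_eq_zero_iff_ae_notMem.1 ((Set.toFinite _).measure_zero _)
    filter_upwards [hne] with s hs
    have h1 : ContinuousAt ((Ioc a b).indicator (fun r => S (b - r) (ψ s))) (s - v₀) := by
      refine ContinuousOn.continuousAt_indicator
        ((hS _).comp (by fun_prop : Continuous fun r : ℝ => b - r)).continuousOn fun hf => hs ?_
      rcases hab.lt_or_eq with h | rfl
      · rw [frontier_Ioc h] at hf
        rcases hf with hf | hf
        · left; linarith
        · right; rw [mem_singleton_iff] at hf ⊢; linarith
      · simp at hf
    exact ContinuousAt.comp (f := fun v => s - v) h1 (by fun_prop)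

end BoundedFamily

lemma exists_bounded_extension [CompleteSpace X] {T : ℝ → X →L[ℂ] X}
    (hT : ∀ x : X, ContinuousOn (fun t : ℝ => T t x) (Ici 0)) {R : ℝ} (hR : 0 ≤ R) :
    ∃ (S : ℝ → X →L[ℂ] X) (M : ℝ), (∀ u ∈ Icc 0 R, S u = T u) ∧
      (∀ x, Continuous fun u => S u x) ∧ ∀ u, ‖S u‖ ≤ M := by
  have hc : ∀ x, Continuous fun u : Icc (0 : ℝ) R => T u x := fun x =>
    continuousOn_iff_continuous_domRestrict.1 ((hT x).mono Icc_subset_Ici_self)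
  obtain ⟨M, hM⟩ := banach_steinhaus (g := fun u : Icc (0 : ℝ) R => T u) fun x => by
    obtain ⟨C, hC⟩ := (isCompact_range (hc x)).isBounded.exists_norm_le
    exact ⟨C, fun u => hC _ (mem_range_self u)⟩
  refine ⟨fun u => T (projIcc 0 R hR u), M, fun u hu => ?_, fun x => ?_, fun u => hM _⟩
  · simp only [projIcc_of_mem hR hu]
  · exact (hc x).comp continuous_projIcc

/-- The right derivative of `s ↦ T (t - s) (u s)`. -/
lemma hasDerivWithinAt_semigroup_comp {T S : ℝ → X →L[ℂ] X} {M R : ℝ}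
    (hTadd : ∀ s t : ℝ, 0 ≤ s → 0 ≤ t → T (s + t) = T s ∘L T t)
    (hST : ∀ u ∈ Icc 0 R, S u = T u) (hS : ∀ x, Continuous fun u => S u x)
    (hM : ∀ u, ‖S u‖ ≤ M) {u : ℝ → X} {s t : ℝ} {x f : X} (hst : s < t) (hR : t - s ≤ R)
    (hu : HasDerivWithinAt u (x + f) (Ioi s) s) (hx : IsGeneratorValue T (u s) x) :
    HasDerivWithinAt (fun r => S (t - r) (u r)) (S (t - s) f) (Ioi s) s := by
  rw [hasDerivWithinAt_iff_tendsto_slope' self_notMem_Ioi] at hu ⊢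
  have hmap : Tendsto (fun r => r - s) (𝓝[>] s) (𝓝[>] 0) := by
    refine tendsto_nhdsWithin_iff.2 ⟨?_, ?_⟩
    · exact (by simpa using (continuous_sub_right s).tendsto s :
        Tendsto (fun r => r - s) (𝓝 s) (𝓝 0)).mono_left nhdsWithin_le_nhds
    · filter_upwards [self_mem_nhdsWithin] with r hr
      exact sub_pos.2 (mem_Ioi.1 hr)
  have h1 := hu.sub (hx.comp hmap)
  rw [add_sub_cancel_left] at h1
  have h2 : Tendsto (fun r => t - r) (𝓝[>] s) (𝓝 (t - s)) :=
    ((continuous_sub_left t).tendsto s).mono_left nhdsWithin_le_nhds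
  have h3 := ((continuous_uncurry_of_bounded hS hM).tendsto (t - s, f)).comp
    (h2.prodMk_nhds h1)
  refine h3.congr' ?_
  filter_upwards [Ioo_mem_nhdsGT hst] with r hr
  have e1 : S (t - s) = S (t - r) ∘L T (r - s) := by
    rw [hST _ ⟨by linarith, hR⟩, hST _ ⟨by linarith [hr.2], by linarith [hr.1]⟩,
      ← hTadd _ _ (by linarith [hr.2]) (by linarith [hr.1])]
    congr 1; ring
  simp only [Function.comp_apply, slope_def_module, e1, ContinuousLinearMap.comp_apply]
  rw [← smul_sub, ContinuousLinearMap.map_smul_of_tower, ← map_sub]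
  congr 2
  abel

lemma variation_of_constants_of_isGeneratorValue [CompleteSpace X] {T : ℝ → X →L[ℂ] X}
    (hT0 : T 0 = 1)
    (hTadd : ∀ s t : ℝ, 0 ≤ s → 0 ≤ t → T (s + t) = T s ∘L T t)
    (hTcont : ∀ x : X, ContinuousOn (fun t : ℝ => T t x) (Ici 0))
    {ω ψ : ℝ → X} (hω : Continuous ω) (hψ : Integrable ψ) {t₀ t : ℝ} (ht : t₀ ≤ t)
    (hgen : ∀ s ∈ Ico t₀ t, ∀ h ∈ Ioc (0 : ℝ) 1, IsGeneratorValue T (∫ r in s..(s + h), ω r)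
      (ω (s + h) - ω s - ∫ r in s..(s + h), ψ r)) :
    ω t = T (t - t₀) (ω t₀) + ∫ s in t₀..t, T (t - s) (ψ s) := by
  obtain ⟨S, M, hST, hS, hM⟩ := exists_bounded_extension hTcont (sub_nonneg.2 ht)
  have hjoint := continuous_uncurry_of_bounded hS hM
  have hψi : ∀ a b, IntervalIntegrable ψ volume a b := fun a b => hψ.intervalIntegrable
  have hωi : ∀ a b, IntervalIntegrable ω volume a b := fun a b => hω.intervalIntegrable a b
  have hshift : ∀ (f : ℝ → X), (∀ a b, IntervalIntegrable f volume a b) → ∀ s h : ℝ,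
      ∫ r in s..(s + h), f r = (∫ r in (0 : ℝ)..(s + h), f r) - ∫ r in (0 : ℝ)..s, f r :=
    fun f hf s h => (intervalIntegral.integral_interval_sub_left (hf _ _) (hf _ _)).symm
  have hmean : ∀ (f : ℝ → X) (s h : ℝ),
      ∫ r in s..(s + h), f r = ∫ v in (0 : ℝ)..h, f (s + v) := fun f s h => by
    simp [intervalIntegral.integral_comp_add_left]
  have hmain : ∀ h ∈ Ioc (0 : ℝ) 1,
      h⁻¹ • ∫ v in (0 : ℝ)..h, ∫ s in t₀..t, S (t - s) (ψ (s + v)) =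
        S (t - t) (h⁻¹ • ∫ v in (0 : ℝ)..h, ω (t + v)) -
          S (t - t₀) (h⁻¹ • ∫ v in (0 : ℝ)..h, ω (t₀ + v)) := by
    intro h hh
    have hfc : Continuous fun s : ℝ => h⁻¹ • ∫ r in s..(s + h), ψ r := by
      simp only [hshift ψ hψi]
      have := intervalIntegral.continuous_primitive hψi 0
      fun_prop
    have hWd : ∀ s, HasDerivAt (fun s : ℝ => ∫ r in (0 : ℝ)..s, ω r) (ω s) s :=
      fun s => (hω.integral_hasStrictDerivAt 0 s).hasDerivAt
    have hud : ∀ s, HasDerivAt (fun s : ℝ => h⁻¹ • ∫ r in s..(s + h), ω r)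
        (h⁻¹ • (ω (s + h) - ω s)) s := by
      intro s
      simp only [hshift ω hωi]
      exact (((hWd (s + h)).comp_add_const s h).sub (hWd s)).const_smul h⁻¹
    have huc : Continuous fun s : ℝ => h⁻¹ • ∫ r in s..(s + h), ω r :=
      continuous_iff_continuousAt.2 fun s => (hud s).continuousAt
    have hsub : Continuous fun s : ℝ => t - s := by fun_prop
    have hftc := intervalIntegral.integral_eq_sub_of_hasDeriv_right
      (f := fun s => S (t - s) (h⁻¹ • ∫ r in s..(s + h), ω r))
      (f' := fun s => S (t - s) (h⁻¹ • ∫ r in s..(s + h), ψ r)) (a := t₀) (b := t)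
      (hjoint.comp (hsub.prodMk huc)).continuousOn
      (fun s hs => by
        rw [min_eq_left ht, max_eq_right ht] at hs
        refine hasDerivWithinAt_semigroup_comp hTadd hST hS hM hs.2 (by linarith [hs.1])
          (u := fun s : ℝ => h⁻¹ • ∫ r in s..(s + h), ω r) ?_
          ((hgen s ⟨hs.1.le, hs.2⟩ h hh).smul h⁻¹)
        rw [← smul_add, sub_add_cancel]
        exact (hud s).hasDerivWithinAt)
      ((hjoint.comp (hsub.prodMk hfc)).intervalIntegrable _ _)
    rw [← hmean ω, ← hmean ω, ← hftc,
      ← intervalIntegral_convolution_swap hS hM (k := fun s _ => t - s) (by fun_prop) hψ ht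
        hh.1.le, ← intervalIntegral.integral_smul]
    refine intervalIntegral.integral_congr fun s _ => ?_
    rw [ContinuousLinearMap.map_smul_of_tower, hmean ψ,
      ContinuousLinearMap.intervalIntegral_comp_comm]
    exact (hψ.comp_add_left s).intervalIntegrable
  have hlim1 := mean_comp_add_tendsto (continuous_convolution hS hM hψ ht) 0
  have hlim2 := (((S (t - t)).continuous.tendsto _).comp (mean_comp_add_tendsto hω t)).sub
    (((S (t - t₀)).continuous.tendsto _).comp (mean_comp_add_tendsto hω t₀))
  simp only [zero_add, add_zero] at hlim1
  have heq := tendsto_nhds_unique hlim1 (hlim2.congr' (by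
    filter_upwards [Ioc_mem_nhdsGT zero_lt_one] with h hh
    exact (hmain h hh).symm))
  have hint : ∫ s in t₀..t, S (t - s) (ψ s) = ∫ s in t₀..t, T (t - s) (ψ s) := by
    refine intervalIntegral.integral_congr fun s hs => ?_
    rw [uIcc_of_le ht] at hs
    simp only [hST (t - s) ⟨by linarith [hs.2], by linarith [hs.1]⟩]
  rw [hint, hST (t - t) (by simp [ht]), hST (t - t₀) (by simp [ht]), sub_self, hT0] at heq
  rw [heq]
  simp

lemma isGeneratorValue_of_variation_of_constants [CompleteSpace X] {T : ℝ → X →L[ℂ] X}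
    (hT0 : T 0 = 1)
    (hTcont : ∀ x : X, ContinuousOn (fun t : ℝ => T t x) (Ici 0))
    {ω ψ : ℝ → X} (hω : Continuous ω) (hψ : Integrable ψ) {t₀ t : ℝ} (ht : t₀ ≤ t)
    (hvoc : ∀ s ∈ Icc t₀ t, ∀ h ∈ Ioc (0 : ℝ) 1,
      ω (s + h) = T h (ω s) + ∫ r in s..(s + h), T (s + h - r) (ψ r)) :
    IsGeneratorValue T (∫ r in t₀..t, ω r) (ω t - ω t₀ - ∫ r in t₀..t, ψ r) := by
  obtain ⟨S, M, hST, hS, hM⟩ := exists_bounded_extension hTcont zero_le_one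
  have hjoint := continuous_uncurry_of_bounded hS hM
  have hψi : ∀ a b, IntervalIntegrable ψ volume a b := fun a b => hψ.intervalIntegrable
  have hωi : ∀ a b, IntervalIntegrable ω volume a b := fun a b => hω.intervalIntegrable a b
  have hΦ : Continuous fun v : ℝ => ∫ s in t₀..t, ψ (s + v) := by
    have h1 := intervalIntegral.continuous_primitive hψi 0
    have h2 : ∀ v : ℝ, ∫ s in t₀..t, ψ (s + v) =
        (∫ r in (0 : ℝ)..(t + v), ψ r) - ∫ r in (0 : ℝ)..(t₀ + v), ψ r := fun v => by
      rw [intervalIntegral.integral_comp_add_right,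
        intervalIntegral.integral_interval_sub_left (hψi _ _) (hψi _ _)]
    simp only [h2]
    fun_prop
  have hmain : ∀ h ∈ Ioc (0 : ℝ) 1,
      T h (∫ r in t₀..t, ω r) - ∫ r in t₀..t, ω r =
        (∫ v in (0 : ℝ)..h, ω (t + v)) - (∫ v in (0 : ℝ)..h, ω (t₀ + v)) -
          ∫ v in (0 : ℝ)..h, S (h - v) (∫ s in t₀..t, ψ (s + v)) := by
    intro h hh
    have hTω : Continuous fun s => T h (ω s) := (T h).continuous.comp hω
    have e1 : ∫ v in (0 : ℝ)..h, S (h - v) (∫ s in t₀..t, ψ (s + v)) =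
        (∫ s in t₀..t, ω (s + h)) - T h (∫ r in t₀..t, ω r) := by
      rw [← ContinuousLinearMap.intervalIntegral_comp_comm _ (hωi _ _),
        ← intervalIntegral.integral_sub
          ((by fun_prop : Continuous fun s => ω (s + h)).intervalIntegrable _ _)
          (hTω.intervalIntegrable _ _)]
      have e2 : ∀ v, S (h - v) (∫ s in t₀..t, ψ (s + v)) =
          ∫ s in t₀..t, S (h - v) (ψ (s + v)) := fun v =>
        (ContinuousLinearMap.intervalIntegral_comp_comm _
          (hψ.comp_add_right v).intervalIntegrable).symm
      simp only [e2]
      rw [← intervalIntegral_convolution_swap hS hM (k := fun _ v => h - v) (by fun_prop) hψ ht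
        hh.1.le]
      refine intervalIntegral.integral_congr fun s hs => ?_
      rw [uIcc_of_le ht] at hs
      rw [hvoc s hs h hh, add_sub_cancel_left]
      have e3 := intervalIntegral.integral_comp_add_left (a := 0) (b := h)
        (fun r => T (s + h - r) (ψ r)) s
      rw [add_zero] at e3
      rw [← e3]
      refine intervalIntegral.integral_congr fun v hv => ?_
      rw [uIcc_of_le hh.1.le] at hv
      rw [add_sub_add_left_eq_sub, hST _ ⟨by linarith [hv.2], by linarith [hv.1, hh.2]⟩]
    rw [e1]
    simp only [intervalIntegral.integral_comp_add_left, intervalIntegral.integral_comp_add_right,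
      add_zero]
    have e4 := intervalIntegral.integral_add_adjacent_intervals (hωi t₀ t) (hωi t (t + h))
    have e5 := intervalIntegral.integral_add_adjacent_intervals (hωi t₀ (t₀ + h))
      (hωi (t₀ + h) (t + h))
    rw [eq_sub_of_add_eq' e4, eq_sub_of_add_eq' e5]
    abel
  have hlim := ((mean_comp_add_tendsto hω t).sub (mean_comp_add_tendsto hω t₀)).sub
    (mean_tendsto (F := fun h v => S (h - v) (∫ s in t₀..t, ψ (s + v)))
      (hjoint.comp ((continuous_fst.sub continuous_snd).prodMk (hΦ.comp continuous_snd))))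
  rw [sub_self, hST 0 (by simp), hT0] at hlim
  simp only [add_zero, one_apply_eq_self] at hlim
  refine hlim.congr' ?_
  filter_upwards [Ioc_mem_nhdsGT zero_lt_one] with h hh
  rw [hmain h hh, smul_sub, smul_sub]

section OnInterval

variable {J : Set ℝ} {φ ω : ℝ → X}

lemma uIcc_subset_of_isUpperSet (hJ : IsUpperSet J) {a b : ℝ} (ha : a ∈ J) (hb : b ∈ J) :
    uIcc a b ⊆ J := fun _ hx =>
  hJ hx.1 (by rcases min_choice a b with h | h <;> rwa [h])

lemma hasDerivWithinAt_mean [CompleteSpace X] (hJ : IsUpperSet J) {f : ℝ → X}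
    (hf : Continuous f) (hωf : EqOn ω f J) {h : ℝ} (hh : 0 < h) {t : ℝ} (ht : t ∈ J) :
    HasDerivWithinAt (fun τ : ℝ => (1 / h) • ∫ s in (0 : ℝ)..h, ω (τ + s))
      ((1 / h) • (ω (t + h) - ω t)) J t := by
  have hW : ∀ s, HasDerivAt (fun s : ℝ => ∫ r in (0 : ℝ)..s, f r) (f s) s :=
    fun s => (hf.integral_hasStrictDerivAt 0 s).hasDerivAt
  have hd : HasDerivWithinAt (fun τ : ℝ => (1 / h) •
      ((∫ r in (0 : ℝ)..(τ + h), f r) - ∫ r in (0 : ℝ)..τ, f r))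
      ((1 / h) • (f (t + h) - f t)) J t :=
    ((((hW (t + h)).comp_add_const t h).sub (hW t)).const_smul (1 / h)).hasDerivWithinAt
  have heq : ∀ τ ∈ J, (1 / h) • ∫ s in (0 : ℝ)..h, ω (τ + s) = (1 / h) •
      ((∫ r in (0 : ℝ)..(τ + h), f r) - ∫ r in (0 : ℝ)..τ, f r) := fun τ hτ => by
    rw [intervalIntegral.integral_interval_sub_left (hf.intervalIntegrable _ _)
      (hf.intervalIntegrable _ _), intervalIntegral.integral_comp_add_left, add_zero,
      intervalIntegral.integral_congr fun r hr =>
        hωf (uIcc_subset_of_isUpperSet hJ hτ (hJ (by linarith) hτ) hr)]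
  rw [hωf ht, hωf (hJ (by linarith : t ≤ t + h) ht)]
  exact hd.congr heq (heq t ht)

variable {T : ℝ → X →L[ℂ] X} {D : Set X} {A : X → X}

/-- The increments of `ω` satisfy the integrated equation `u' = Au + φ` on `J`. -/
def IsIncrementSolution (T : ℝ → X →L[ℂ] X) (J : Set ℝ) (φ ω : ℝ → X) : Prop :=
  ∀ t ∈ J, ∀ h : ℝ, 0 < h → IsGeneratorValue T (∫ s in t..(t + h), ω s)
    (ω (t + h) - ω t - ∫ s in t..(t + h), φ s)

lemma mild_iff_isIncrementSolution
    (hAD : ∀ x y, IsGeneratorValue T x y ↔ x ∈ D ∧ y = A x)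
    (hJ : IsUpperSet J) (h0 : (0 : ℝ) ∈ J) (hφ : LocallyIntegrableOn φ J)
    (hω : ContinuousOn ω J) :
    (∀ t ∈ J, (∫ s in (0 : ℝ)..t, ω s) ∈ D ∧
      ω t = ω 0 + A (∫ s in (0 : ℝ)..t, ω s) + ∫ s in (0 : ℝ)..t, φ s) ↔
    IsIncrementSolution T J φ ω := by
  have hω0 : ∀ t ∈ J, IntervalIntegrable ω volume 0 t := fun t ht =>
    (hω.mono (uIcc_subset_of_isUpperSet hJ h0 ht)).intervalIntegrable
  have hφ0 : ∀ t ∈ J, IntervalIntegrable φ volume 0 t := fun t ht =>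
    intervalIntegrable_iff.2 ((hφ.integrableOn_compact_subset
      (uIcc_subset_of_isUpperSet hJ h0 ht) isCompact_uIcc).mono_set uIoc_subset_uIcc)
  have hgen : (∀ t ∈ J, (∫ s in (0 : ℝ)..t, ω s) ∈ D ∧
      ω t = ω 0 + A (∫ s in (0 : ℝ)..t, ω s) + ∫ s in (0 : ℝ)..t, φ s) ↔
      ∀ t ∈ J, IsGeneratorValue T (∫ s in (0 : ℝ)..t, ω s)
        (ω t - ω 0 - ∫ s in (0 : ℝ)..t, φ s) := by
    refine forall₂_congr fun t _ => ?_
    rw [hAD, sub_sub, sub_eq_iff_eq_add, add_comm (ω 0) (A _), add_assoc]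
  rw [hgen]
  constructor
  · intro H t ht h hh
    have hth : t + h ∈ J := hJ (by linarith) ht
    have := (H (t + h) hth).sub (H t ht)
    rw [intervalIntegral.integral_interval_sub_left (hω0 _ hth) (hω0 _ ht)] at this
    convert this using 1
    rw [← intervalIntegral.integral_interval_sub_left (hφ0 _ hth) (hφ0 _ ht)]
    abel
  · intro H t ht
    rcases lt_trichotomy 0 t with h | rfl | h
    · simpa using H 0 h0 t h
    · simpa using IsGeneratorValue.zero T
    · have := (IsGeneratorValue.zero T).sub (H t ht (-t) (by linarith))
      rw [add_neg_cancel, zero_sub, zero_sub, ← intervalIntegral.integral_symm] at this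
      convert this using 1
      rw [intervalIntegral.integral_symm]
      abel

lemma mean_classical_iff_isIncrementSolution [CompleteSpace X]
    (hAD : ∀ x y, IsGeneratorValue T x y ↔ x ∈ D ∧ y = A x)
    (hJ : IsUpperSet J) {f : ℝ → X} (hf : Continuous f) (hωf : EqOn ω f J) :
    (∀ h : ℝ, 0 < h →
      (∀ t ∈ J, ((1 / h) • ∫ s in (0 : ℝ)..h, ω (t + s)) ∈ D) ∧
      (∀ t ∈ J, HasDerivWithinAt
        (fun τ : ℝ => (1 / h) • ∫ s in (0 : ℝ)..h, ω (τ + s))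
        (A ((1 / h) • ∫ s in (0 : ℝ)..h, ω (t + s))
          + (1 / h) • ∫ s in (0 : ℝ)..h, φ (t + s)) J t) ∧
      ContinuousOn (fun t : ℝ => A ((1 / h) • ∫ s in (0 : ℝ)..h, ω (t + s))
          + (1 / h) • ∫ s in (0 : ℝ)..h, φ (t + s)) J) ↔
    IsIncrementSolution T J φ ω := by
  have hω : ContinuousOn ω J := hf.continuousOn.congr hωf
  constructor
  · intro H t ht h hh
    obtain ⟨hD, hd, -⟩ := H h hh
    have huniq : UniqueDiffWithinAt ℝ J t :=
      (uniqueDiffWithinAt_Ioi t).mono fun s hs => hJ (mem_Ioi.1 hs).le ht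
    have heq := huniq.eq_deriv _ (hd t ht) (hasDerivWithinAt_mean hJ hf hωf hh ht)
    have hg := ((hAD _ _).2 ⟨hD t ht, rfl⟩).smul h
    rw [eq_sub_of_add_eq heq, ← smul_sub, smul_smul, smul_smul, mul_one_div_cancel hh.ne',
      one_smul, one_smul] at hg
    simpa [intervalIntegral.integral_comp_add_left] using hg
  · intro H h hh
    have hg : ∀ t ∈ J, IsGeneratorValue T ((1 / h) • ∫ s in (0 : ℝ)..h, ω (t + s))
        ((1 / h) • (ω (t + h) - ω t - ∫ s in (0 : ℝ)..h, φ (t + s))) := fun t ht => by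
      simpa [intervalIntegral.integral_comp_add_left] using (H t ht h hh).smul (1 / h)
    have hA : ∀ t ∈ J, A ((1 / h) • ∫ s in (0 : ℝ)..h, ω (t + s))
        + (1 / h) • ∫ s in (0 : ℝ)..h, φ (t + s) = (1 / h) • (ω (t + h) - ω t) :=
      fun t ht => by rw [← ((hAD _ _).1 (hg t ht)).2, ← smul_add, sub_add_cancel]
    refine ⟨fun t ht => ((hAD _ _).1 (hg t ht)).1, fun t ht => ?_, ?_⟩
    · rw [hA t ht]
      exact hasDerivWithinAt_mean hJ hf hωf hh ht
    · refine ContinuousOn.congr ?_ hA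
      refine ContinuousOn.const_smul (ContinuousOn.sub ?_ hω) _
      exact hω.comp (by fun_prop) fun t ht => hJ (by linarith : t ≤ t + h) ht

lemma variation_of_constants_iff_isIncrementSolution [CompleteSpace X]
    (hT0 : T 0 = 1)
    (hTadd : ∀ s t : ℝ, 0 ≤ s → 0 ≤ t → T (s + t) = T s ∘L T t)
    (hTcont : ∀ x : X, ContinuousOn (fun t : ℝ => T t x) (Ici 0))
    (hJ : IsUpperSet J) (hφ : LocallyIntegrableOn φ J)
    {f : ℝ → X} (hf : Continuous f) (hωf : EqOn ω f J) :
    (∀ t₀ ∈ J, ∀ t ∈ J, t₀ ≤ t →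
      ω t = T (t - t₀) (ω t₀) + ∫ s in t₀..t, T (t - s) (φ s)) ↔
    IsIncrementSolution T J φ ω := by
  have hint : ∀ t₀ ∈ J, ∀ b, Integrable ((Icc t₀ b).indicator φ) := fun t₀ h₀ b =>
    (integrable_indicator_iff measurableSet_Icc).2
      (hφ.integrableOn_compact_subset (fun s hs => hJ hs.1 h₀) isCompact_Icc)
  have hind : ∀ {t₀ b s h r : ℝ}, t₀ ≤ s → 0 ≤ h → s + h ≤ b → r ∈ uIcc s (s + h) →
      φ r = (Icc t₀ b).indicator φ r := fun hs hh hb hr => by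
    rw [uIcc_of_le (by linarith)] at hr
    rw [indicator_of_mem (mem_Icc.2 ⟨by linarith [hr.1], by linarith [hr.2]⟩)]
  have hωi : ∀ {s h : ℝ}, s ∈ J → 0 ≤ h → ∫ r in s..(s + h), ω r = ∫ r in s..(s + h), f r :=
    fun hs hh => intervalIntegral.integral_congr fun r hr =>
      hωf (uIcc_subset_of_isUpperSet hJ hs (hJ (by linarith) hs) hr)
  constructor
  · intro H t ht h hh
    have hth : t + h ∈ J := hJ (by linarith) ht
    have key := isGeneratorValue_of_variation_of_constants hT0 hTcont hf (hint t ht (t + h + 1))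
      (by linarith : t ≤ t + h) fun s hs k hk => by
        have hsJ : s ∈ J := hJ hs.1 ht
        have hskJ : s + k ∈ J := hJ (by linarith [hk.1]) hsJ
        rw [← hωf hsJ, ← hωf hskJ, H s hsJ _ hskJ (by linarith [hk.1]), add_sub_cancel_left]
        congr 1
        refine intervalIntegral.integral_congr fun r hr => ?_
        simp only [← hind hs.1 hk.1.le (by linarith [hs.2, hk.2] : s + k ≤ t + h + 1) hr]
    rw [hωi ht hh.le, hωf hth, hωf ht, intervalIntegral.integral_congr fun r hr =>
      hind le_rfl hh.le (by linarith : t + h ≤ t + h + 1) hr]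
    exact key
  · intro H t₀ h₀ t ht hle
    have key := variation_of_constants_of_isGeneratorValue hT0 hTadd hTcont hf
      (hint t₀ h₀ (t + 1)) hle fun s hs h hh => by
        have hsJ : s ∈ J := hJ hs.1 h₀
        have hshJ : s + h ∈ J := hJ (by linarith [hh.1]) hsJ
        rw [← hωi hsJ hh.1.le, ← hωf hsJ, ← hωf hshJ,
          ← intervalIntegral.integral_congr fun r hr =>
            hind hs.1 hh.1.le (by linarith [hs.2, hh.2] : s + h ≤ t + 1) hr]
        exact H s hsJ h hh.1
    rw [hωf ht, hωf h₀, key]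
    congr 1
    refine intervalIntegral.integral_congr fun r hr => ?_
    have hr' : r ∈ uIcc t₀ (t₀ + (t - t₀)) := by rwa [add_sub_cancel]
    simp only [← hind le_rfl (sub_nonneg.2 hle) (by linarith : t₀ + (t - t₀) ≤ t + 1) hr']

end OnInterval

end

/-- **Lemma 3.1.** Let `T` be a `C₀`-semigroup on `X` with
generator `A`, `J ∈ {ℝ, [0,∞)}`, `φ ∈ L¹_loc(J, X)` and `ω : J → X`.  Then the
following are equivalent:
(i) `ω` is a mild solution of `ω' = Aω + φ` on `J`;
(ii) `ω` is continuous and for every `h > 0` the mean `M_h ω` is a classical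
solution of `u' = Au + M_h φ` on `J`;
(iii) `ω` is continuous and satisfies the variation-of-constants formula
`ω(t) = T(t-t₀)ω(t₀) + ∫_{t₀}^t T(t-s)φ(s) ds` for all `t₀ ≤ t` in `J`. -/
theorem stmt19 {X : Type*} [NormedAddCommGroup X] [NormedSpace ℂ X] [CompleteSpace X]
    (T : ℝ → X →L[ℂ] X)
    (hT0 : T 0 = 1)
    (hTadd : ∀ s t : ℝ, 0 ≤ s → 0 ≤ t → T (s + t) = T s ∘L T t)
    (hTcont : ∀ x : X, ContinuousOn (fun t : ℝ => T t x) (Set.Ici 0))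
    (D : Set X) (A : X → X)
    (hD : D = {x : X | ∃ y : X,
      Tendsto (fun h : ℝ => h⁻¹ • (T h x - x)) (nhdsWithin 0 (Set.Ioi 0)) (nhds y)})
    (hA : ∀ x ∈ D,
      Tendsto (fun h : ℝ => h⁻¹ • (T h x - x)) (nhdsWithin 0 (Set.Ioi 0)) (nhds (A x)))
    (J : Set ℝ) (hJ : J = Set.univ ∨ J = Set.Ici 0)
    (φ : ℝ → X) (hφ : LocallyIntegrableOn φ J (volume : Measure ℝ))
    (ω : ℝ → X) :
    -- (i) ↔ (ii)
    ((ContinuousOn ω J ∧ ∀ t ∈ J, (∫ s in (0 : ℝ)..t, ω s) ∈ D ∧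
        ω t = ω 0 + A (∫ s in (0 : ℝ)..t, ω s) + ∫ s in (0 : ℝ)..t, φ s)
      ↔
      (ContinuousOn ω J ∧ ∀ h : ℝ, 0 < h →
        (∀ t ∈ J, ((1 / h) • ∫ s in (0 : ℝ)..h, ω (t + s)) ∈ D) ∧
        (∀ t ∈ J, HasDerivWithinAt
          (fun τ : ℝ => (1 / h) • ∫ s in (0 : ℝ)..h, ω (τ + s))
          (A ((1 / h) • ∫ s in (0 : ℝ)..h, ω (t + s))
            + (1 / h) • ∫ s in (0 : ℝ)..h, φ (t + s)) J t) ∧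
        ContinuousOn (fun t : ℝ => A ((1 / h) • ∫ s in (0 : ℝ)..h, ω (t + s))
            + (1 / h) • ∫ s in (0 : ℝ)..h, φ (t + s)) J)) ∧
    -- (i) ↔ (iii)
    ((ContinuousOn ω J ∧ ∀ t ∈ J, (∫ s in (0 : ℝ)..t, ω s) ∈ D ∧
        ω t = ω 0 + A (∫ s in (0 : ℝ)..t, ω s) + ∫ s in (0 : ℝ)..t, φ s)
      ↔
      (ContinuousOn ω J ∧ ∀ t₀ ∈ J, ∀ t ∈ J, t₀ ≤ t →
        ω t = T (t - t₀) (ω t₀) + ∫ s in t₀..t, T (t - s) (φ s))) := by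
  have hAD : ∀ x y, IsGeneratorValue T x y ↔ x ∈ D ∧ y = A x := by
    intro x y
    constructor
    · intro h
      have hx : x ∈ D := hD ▸ ⟨y, h⟩
      exact ⟨hx, tendsto_nhds_unique h (hA x hx)⟩
    · rintro ⟨hx, rfl⟩
      exact hA x hx
  have hup : IsUpperSet J := by
    rcases hJ with rfl | rfl
    exacts [isUpperSet_univ, isUpperSet_Ici 0]
  have h0 : (0 : ℝ) ∈ J := by rcases hJ with rfl | rfl <;> simp
  have hext : ContinuousOn ω J → ∃ f : ℝ → X, Continuous f ∧ EqOn ω f J := by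
    intro hω
    rcases hJ with rfl | rfl
    · exact ⟨ω, continuousOn_univ.1 hω, fun _ _ => rfl⟩
    · refine ⟨fun t => ω (max t 0), hω.comp_continuous (by fun_prop) fun t => mem_Ici.2 (le_max_right _ _),
        fun t ht => ?_⟩
      simp only [max_eq_left (mem_Ici.1 ht)]
  refine ⟨and_congr_right fun hω => ?_, and_congr_right fun hω => ?_⟩ <;>
    obtain ⟨f, hf, hωf⟩ := hext hω <;>
    rw [mild_iff_isIncrementSolution hAD hup h0 hφ hω]
  · exact (mean_classical_iff_isIncrementSolution hAD hup hf hωf).symm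
  · exact (variation_of_constants_iff_isIncrementSolution hT0 hTadd hTcont hup hφ hf hωf).symm
end
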